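/- There exists a constant C > 0 such that for every integer l ≥ 0, every real t ≠ 0 and every Schwartz function u₀ : ℝ² → ℂ, ‖U_φ(t) P_{Δl} u₀‖_{L^∞(ℝ²)} ≤ C |t|^{−1} 2^{−l} ‖u₀‖_{L¹(ℝ²)}, where U_φ(t)u₀ = ℱ⁻¹(e^{−itφ(ξ,η)} ℱu₀) with φ(ξ,η) = ξ³ − 3ξη², and P_{Δl} = ℱ⁻¹ χ_{{2^l ≤ |(ξ,η)| < 2^{l+1}}} ℱ is the Littlewood–Paley projection to frequencies of size comparable to 2^l. -/

import Mathlib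

open MeasureTheory

/-- The Fourier transform on `ℝ²`. -/
noncomputable def FT2 (f : ℝ × ℝ → ℂ) : ℝ × ℝ → ℂ :=
  fun w => ∫ v : ℝ × ℝ, Complex.exp (-Complex.I * (v.1 * w.1 + v.2 * w.2)) * f v

/-- The phase function of the linearized Novikov-Veselov equation. -/
def phiNV (ξ η : ℝ) : ℝ := ξ ^ 3 - 3 * ξ * η ^ 2

/-- `U_φ(t) P_{Δl} u₀ = ℱ⁻¹(χ_{2^l ≤ |(ξ,η)| < 2^{l+1}} e^{−itφ} ℱu₀)`, the free
evolution of the Littlewood-Paley piece of `u₀` at frequency `2^l`. -/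
noncomputable def UphiLP (l : ℕ) (t : ℝ) (u₀ : ℝ × ℝ → ℂ) : ℝ × ℝ → ℂ :=
  fun v => (2 * Real.pi : ℂ)⁻¹ ^ 2 *
    ∫ w : ℝ × ℝ,
      (if (2 : ℝ) ^ l ≤ Real.sqrt (w.1 ^ 2 + w.2 ^ 2) ∧
          Real.sqrt (w.1 ^ 2 + w.2 ^ 2) < (2 : ℝ) ^ (l + 1) then (1 : ℂ) else 0) *
        Complex.exp (Complex.I * (v.1 * w.1 + v.2 * w.2)
          - Complex.I * t * phiNV w.1 w.2) * FT2 u₀ w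

/-- The unimodular exponential `x ↦ e^{ix}`. -/
noncomputable def cis (x : ℝ) : ℂ := Complex.exp (x * Complex.I)

lemma norm_cis (x : ℝ) : ‖cis x‖ = 1 := Complex.norm_exp_ofReal_mul_I x

lemma cis_zero : cis 0 = 1 := by simp [cis]

lemma cis_add (x y : ℝ) : cis (x + y) = cis x * cis y := by
  simp [cis, add_mul, Complex.exp_add]

lemma conj_cis (x : ℝ) : (starRingEnd ℂ) (cis x) = cis (-x) := by
  simp [cis, ← Complex.exp_conj]

lemma continuous_cis : Continuous cis := by unfold cis; fun_prop

lemma norm_cis_sub_cis_le (x y : ℝ) : ‖cis x - cis y‖ ≤ |x - y| := by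
  have h : cis x - cis y = cis y * (cis (x - y) - 1) := by
    rw [mul_sub, ← cis_add]; simp
  rw [h, norm_mul, norm_cis, one_mul, cis, mul_comm]
  exact Real.norm_exp_I_mul_ofReal_sub_one_le

lemma HasDerivAt.cis {f : ℝ → ℝ} {f' x : ℝ} (hf : HasDerivAt f f' x) :
    HasDerivAt (fun y => _root_.cis (f y)) (f' * Complex.I * _root_.cis (f x)) x := by
  have h := (hf.ofReal_comp.mul_const Complex.I).cexp
  refine h.congr_deriv ?_
  change _ = f' * Complex.I * Complex.exp (f x * Complex.I)
  ring

lemma ContinuousOn.cis {f : ℝ → ℝ} {s : Set ℝ} (hf : ContinuousOn f s) :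
    ContinuousOn (fun y => _root_.cis (f y)) s :=
  continuous_cis.comp_continuousOn hf

/-- Integration against an amplitude of bounded variation. -/
lemma norm_integral_mul_le_of_primitive {a b K : ℝ} (hab : a ≤ b) {g ψ ψ' : ℝ → ℂ} {V v : ℝ → ℝ}
    (hg : ContinuousOn g (Set.Icc a b))
    (hψ : ∀ x ∈ Set.Icc a b, HasDerivAt ψ (ψ' x) x) (hψ' : ContinuousOn ψ' (Set.Icc a b))
    (hV : ∀ x ∈ Set.Icc a b, HasDerivAt V (v x) x) (hv : ContinuousOn v (Set.Icc a b))
    (hle : ∀ x ∈ Set.Icc a b, ‖ψ' x‖ ≤ v x)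
    (hK : ∀ x ∈ Set.Icc a b, ‖∫ y in a..x, g y‖ ≤ K) :
    ‖∫ x in a..b, g x * ψ x‖ ≤ K * (‖ψ b‖ + (V b - V a)) := by
  have hu : Set.uIcc a b = Set.Icc a b := Set.uIcc_of_le hab
  have hψc : ContinuousOn ψ (Set.Icc a b) := fun x hx =>
    (hψ x hx).continuousAt.continuousWithinAt
  set S : ℝ → ℂ := fun x => ∫ y in a..x, g y with hS
  have hgi : IntervalIntegrable g volume a b := (hu ▸ hg).intervalIntegrable
  have hSc : ContinuousOn S (Set.uIcc a b) :=
    intervalIntegral.continuousOn_primitive_interval (by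
      rw [hu]; exact hg.integrableOn_Icc)
  have hSd : ∀ x ∈ Set.Ioo (min a b) (max a b), HasDerivWithinAt S (g x) (Set.Ioi x) x := by
    intro x hx
    rw [min_eq_left hab, max_eq_right hab] at hx
    have hnb : Set.Icc a b ∈ nhds x := Icc_mem_nhds hx.1 hx.2
    have hc : ContinuousAt g x := hg.continuousAt hnb
    refine (intervalIntegral.integral_hasDerivAt_right ?_ ?_ hc).hasDerivWithinAt
    · exact hgi.mono_set (by rw [hu, Set.uIcc_of_le hx.1.le]; exact Set.Icc_subset_Icc_right hx.2.le)
    · exact ⟨Set.Icc a b, hnb, hg.aestronglyMeasurable measurableSet_Icc⟩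
  have hparts := intervalIntegral.integral_mul_deriv_eq_deriv_mul_of_hasDeriv_right
    (u := ψ) (v := S) (u' := ψ') (v' := g) (hu ▸ hψc) hSc
    (fun x hx => (hψ x (by
      rw [min_eq_left hab, max_eq_right hab] at hx
      exact Set.Ioo_subset_Icc_self hx)).hasDerivWithinAt) hSd
    (hu ▸ hψ').intervalIntegrable hgi
  have hcomm : ∫ x in a..b, g x * ψ x = ∫ x in a..b, ψ x * g x := by
    simp_rw [mul_comm]
  have hvi : IntervalIntegrable v volume a b := (hu ▸ hv).intervalIntegrable
  have hvV : ∫ x in a..b, v x = V b - V a :=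
    intervalIntegral.integral_eq_sub_of_hasDerivAt (fun x hx => hV x (hu ▸ hx)) hvi
  have hK0 : 0 ≤ K := (norm_nonneg _).trans (hK a ⟨le_rfl, hab⟩)
  have h2 : ‖∫ x in a..b, ψ' x * S x‖ ≤ K * (V b - V a) := by
    rw [← hvV, ← intervalIntegral.integral_const_mul]
    refine intervalIntegral.norm_integral_le_of_norm_le hab (ae_of_all _ fun t ht => ?_)
      (hvi.const_mul K)
    have ht' := Set.Ioc_subset_Icc_self ht
    rw [norm_mul, mul_comm]
    exact mul_le_mul (hK t ht') (hle t ht') (norm_nonneg _) hK0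
  have hSa : S a = 0 := by simp [hS]
  rw [hcomm, hparts, hSa, mul_zero, sub_zero]
  calc ‖ψ b * S b - ∫ x in a..b, ψ' x * S x‖
      ≤ ‖ψ b * S b‖ + ‖∫ x in a..b, ψ' x * S x‖ := norm_sub_le _ _
    _ ≤ ‖ψ b‖ * K + K * (V b - V a) := by
        rw [norm_mul]
        gcongr
        exact hK b ⟨hab, le_rfl⟩
    _ = _ := by ring

/-- Splitting an integral at the sign change of a monotone function. -/
lemma norm_integral_le_of_monotone_split {a b C₁ C₂ : ℝ} (hab : a ≤ b) {f : ℝ → ℝ} {F : ℝ → ℂ}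
    (hf : MonotoneOn f (Set.Icc a b)) (hfc : ContinuousOn f (Set.Icc a b))
    (hF : ContinuousOn F (Set.Icc a b)) (hC₁ : 0 ≤ C₁) (hC₂ : 0 ≤ C₂)
    (h₁ : ∀ c ∈ Set.Icc a b, (∀ x ∈ Set.Icc a c, f x ≤ 0) → ‖∫ x in a..c, F x‖ ≤ C₁)
    (h₂ : ∀ c ∈ Set.Icc a b, (∀ x ∈ Set.Icc c b, 0 ≤ f x) → ‖∫ x in c..b, F x‖ ≤ C₂) :
    ‖∫ x in a..b, F x‖ ≤ C₁ + C₂ := by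
  have ha : a ∈ Set.Icc a b := ⟨le_rfl, hab⟩
  have hb : b ∈ Set.Icc a b := ⟨hab, le_rfl⟩
  rcases le_total 0 (f a) with h0 | h0
  · have := h₂ a ha fun x hx => h0.trans (hf ha hx hx.1)
    linarith
  rcases le_total (f b) 0 with h1 | h1
  · have := h₁ b hb fun x hx => (hf hx hb hx.2).trans h1
    linarith
  obtain ⟨c, hc, hc0⟩ := intermediate_value_Icc hab hfc ⟨h0, h1⟩
  have hFi : ∀ x y, a ≤ x → x ≤ y → y ≤ b → IntervalIntegrable F volume x y := by
    intro x y h h' h''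
    refine ContinuousOn.intervalIntegrable ?_
    rw [Set.uIcc_of_le h']
    exact hF.mono (Set.Icc_subset_Icc h h'')
  rw [← intervalIntegral.integral_add_adjacent_intervals (hFi a c le_rfl hc.1 hc.2)
    (hFi c b hc.1 hc.2 le_rfl)]
  refine (norm_add_le _ _).trans (add_le_add (h₁ c hc fun x hx => ?_) (h₂ c hc fun x hx => ?_))
  · rw [← hc0]; exact hf ⟨hx.1, hx.2.trans hc.2⟩ hc hx.2
  · rw [← hc0]; exact hf hc ⟨hc.1.trans hx.1, hx.2⟩ hx.1

/-- First-derivative van der Corput estimate for convex phases. -/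
lemma van_der_corput_first {a b κ : ℝ} (hab : a ≤ b) (hκ : 0 < κ) {f f₁ f₂ : ℝ → ℝ}
    (hf : ∀ x ∈ Set.Icc a b, HasDerivAt f (f₁ x) x)
    (hf₁ : ∀ x ∈ Set.Icc a b, HasDerivAt f₁ (f₂ x) x) (hf₂ : ContinuousOn f₂ (Set.Icc a b))
    (hlb : ∀ x ∈ Set.Icc a b, κ ≤ f₁ x) (hpos : ∀ x ∈ Set.Icc a b, 0 ≤ f₂ x) :
    ‖∫ x in a..b, cis (f x)‖ ≤ 2 / κ := by
  have hfc : ContinuousOn f (Set.Icc a b) := fun x hx => (hf x hx).continuousAt.continuousWithinAt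
  have hf₁c : ContinuousOn f₁ (Set.Icc a b) := fun x hx =>
    (hf₁ x hx).continuousAt.continuousWithinAt
  have hne : ∀ x ∈ Set.Icc a b, f₁ x ≠ 0 := fun x hx => (hκ.trans_le (hlb x hx)).ne'
  have hg : ContinuousOn (fun x => (f₁ x : ℂ) * Complex.I * cis (f x)) (Set.Icc a b) :=
    ((Complex.continuous_ofReal.comp_continuousOn hf₁c).mul continuousOn_const).mul hfc.cis
  have hdiv : ContinuousOn (fun x => f₂ x / f₁ x ^ 2) (Set.Icc a b) :=
    hf₂.div (hf₁c.pow 2) fun x hx => pow_ne_zero 2 (hne x hx)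
  have key := norm_integral_mul_le_of_primitive (K := 2) hab hg
    (ψ := fun x => ((f₁ x)⁻¹ : ℝ) * (-Complex.I))
    (ψ' := fun x => ((-(f₂ x / f₁ x ^ 2) : ℝ) : ℂ) * (-Complex.I))
    (V := fun x => -(f₁ x)⁻¹) (v := fun x => f₂ x / f₁ x ^ 2)
    (fun x hx => by
      have h := ((hf₁ x hx).inv (hne x hx)).ofReal_comp.mul_const (-Complex.I)
      refine h.congr_deriv ?_
      rw [neg_div])
    ((Complex.continuous_ofReal.comp_continuousOn hdiv.neg).mul continuousOn_const)
    (fun x hx => by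
      have h := ((hf₁ x hx).inv (hne x hx)).neg
      refine h.congr_deriv ?_
      ring)
    hdiv
    (fun x hx => by
      rw [norm_mul, norm_neg, Complex.norm_I, mul_one, Complex.norm_real, norm_neg,
        Real.norm_of_nonneg (div_nonneg (hpos x hx) (sq_nonneg _))])
    (fun x hx => by
      have hu : Set.uIcc a x = Set.Icc a x := Set.uIcc_of_le hx.1
      have hsub : Set.Icc a x ⊆ Set.Icc a b := Set.Icc_subset_Icc_right hx.2
      rw [intervalIntegral.integral_eq_sub_of_hasDerivAt (f := fun y => cis (f y))
        (fun y hy => (hf y (hsub (hu ▸ hy))).cis)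
        (ContinuousOn.intervalIntegrable (hu ▸ hg.mono hsub))]
      refine (norm_sub_le _ _).trans ?_
      rw [norm_cis, norm_cis]; norm_num)
  have heq : ∫ x in a..b, (f₁ x : ℂ) * Complex.I * cis (f x) * (((f₁ x)⁻¹ : ℝ) * (-Complex.I))
      = ∫ x in a..b, cis (f x) := by
    refine intervalIntegral.integral_congr fun x hx => ?_
    rw [Set.uIcc_of_le hab] at hx
    have : (f₁ x : ℂ) ≠ 0 := by exact_mod_cast hne x hx
    simp only [Complex.ofReal_inv]
    field_simp
    simp [Complex.I_sq]
  rw [heq] at key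
  refine key.trans ?_
  have hfa := hlb a ⟨le_rfl, hab⟩
  have hfb := hlb b ⟨hab, le_rfl⟩
  rw [norm_mul, norm_neg, Complex.norm_I, mul_one, Complex.norm_real,
    Real.norm_of_nonneg (inv_nonneg.2 (hκ.le.trans hfb))]
  have : (f₁ a)⁻¹ ≤ κ⁻¹ := inv_anti₀ hκ hfa
  rw [div_eq_mul_inv]
  linarith

lemma norm_integral_cis_le {a b : ℝ} (hab : a ≤ b) (f : ℝ → ℝ) :
    ‖∫ x in a..b, cis (f x)‖ ≤ b - a := by
  have := intervalIntegral.norm_integral_le_of_norm_le_const (a := a) (b := b) (C := 1)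
    (f := fun x => cis (f x)) (fun x _ => (norm_cis _).le)
  rwa [one_mul, abs_of_nonneg (sub_nonneg.2 hab)] at this

lemma van_der_corput_second_right {a b μ : ℝ} (hab : a ≤ b) (hμ : 0 < μ) {f f₁ f₂ : ℝ → ℝ}
    (hf : ∀ x ∈ Set.Icc a b, HasDerivAt f (f₁ x) x)
    (hf₁ : ∀ x ∈ Set.Icc a b, HasDerivAt f₁ (f₂ x) x) (hf₂ : ContinuousOn f₂ (Set.Icc a b))
    (ha : 0 ≤ f₁ a) (hlb : ∀ x ∈ Set.Icc a b, μ ≤ f₂ x) :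
    ‖∫ x in a..b, cis (f x)‖ ≤ 3 / √μ := by
  have hs : 0 < √μ := Real.sqrt_pos.2 hμ
  have hss : √μ * √μ = μ := Real.mul_self_sqrt hμ.le
  set ν := 1 / √μ with hν
  have hν0 : 0 < ν := by positivity
  have h3 : 3 / √μ = 3 * ν := by rw [hν]; ring
  rw [h3]
  rcases le_total b (a + ν) with hb | hb
  · exact (norm_integral_cis_le hab f).trans (by linarith)
  have hfc : ContinuousOn f (Set.Icc a b) := fun x hx => (hf x hx).continuousAt.continuousWithinAt
  have hi : ∀ x y, a ≤ x → x ≤ y → y ≤ b →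
      IntervalIntegrable (fun z => cis (f z)) volume x y := by
    intro x y h h' h''
    refine ContinuousOn.intervalIntegrable ?_
    rw [Set.uIcc_of_le h']
    exact (hfc.mono (Set.Icc_subset_Icc h h'')).cis
  rw [← intervalIntegral.integral_add_adjacent_intervals (hi a (a + ν) le_rfl (by linarith) hb)
    (hi (a + ν) b (by linarith) hb le_rfl)]
  have hsub : Set.Icc (a + ν) b ⊆ Set.Icc a b := Set.Icc_subset_Icc_left (by linarith)
  have hgrow : ∀ x ∈ Set.Icc (a + ν) b, √μ ≤ f₁ x := by
    intro x hx
    have hx' := hsub hx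
    have := (convex_Icc a b).mul_sub_le_image_sub_of_le_deriv (f := f₁) (C := μ)
      (fun y hy => (hf₁ y hy).continuousAt.continuousWithinAt)
      (fun y hy => (hf₁ y (interior_subset hy)).differentiableAt.differentiableWithinAt)
      (fun y hy => by rw [(hf₁ y (interior_subset hy)).deriv]; exact hlb y (interior_subset hy))
      a ⟨le_rfl, hab⟩ x hx' hx'.1
    have h1 : μ * ν ≤ μ * (x - a) := by
      gcongr
      linarith [hx.1]
    have h2 : μ * ν = √μ := by rw [hν]; field_simp; rw [sq, hss]
    linarith
  have hA := norm_integral_cis_le (a := a) (b := a + ν) (by linarith) f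
  have hB := van_der_corput_first hb hs (fun x hx => hf x (hsub hx))
    (fun x hx => hf₁ x (hsub hx)) (hf₂.mono hsub) hgrow
    (fun x hx => hμ.le.trans (hlb x (hsub hx)))
  have h2 : 2 / √μ = 2 * ν := by rw [hν]; ring
  refine (norm_add_le _ _).trans ?_
  linarith

/-- Second-derivative van der Corput estimate. -/
lemma van_der_corput_second {a b μ : ℝ} (hab : a ≤ b) (hμ : 0 < μ) {f f₁ f₂ : ℝ → ℝ}
    (hf : ∀ x ∈ Set.Icc a b, HasDerivAt f (f₁ x) x)
    (hf₁ : ∀ x ∈ Set.Icc a b, HasDerivAt f₁ (f₂ x) x) (hf₂ : ContinuousOn f₂ (Set.Icc a b))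
    (hlb : ∀ x ∈ Set.Icc a b, μ ≤ f₂ x) :
    ‖∫ x in a..b, cis (f x)‖ ≤ 6 / √μ := by
  have h0 : (0 : ℝ) ≤ 3 / √μ := by positivity
  have h6 : 6 / √μ = 3 / √μ + 3 / √μ := by ring
  rw [h6]
  have hf₁c : ContinuousOn f₁ (Set.Icc a b) := fun x hx =>
    (hf₁ x hx).continuousAt.continuousWithinAt
  have hfc : ContinuousOn f (Set.Icc a b) := fun x hx => (hf x hx).continuousAt.continuousWithinAt
  have hmono : MonotoneOn f₁ (Set.Icc a b) := monotoneOn_of_deriv_nonneg (convex_Icc a b) hf₁c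
    (fun y hy => (hf₁ y (interior_subset hy)).differentiableAt.differentiableWithinAt)
    (fun y hy => by
      rw [(hf₁ y (interior_subset hy)).deriv]
      exact hμ.le.trans (hlb y (interior_subset hy)))
  refine norm_integral_le_of_monotone_split hab hmono hf₁c hfc.cis h0 h0 ?_ ?_
  · intro c hc hneg
    have hsub : ∀ x ∈ Set.Icc (-c) (-a), -x ∈ Set.Icc a b := fun x hx =>
      ⟨by linarith [hx.2], by linarith [hx.1, hc.2]⟩
    have := van_der_corput_second_right (a := -c) (b := -a) (by linarith [hc.1]) hμ
      (f := fun x => f (-x)) (f₁ := fun x => -f₁ (-x)) (f₂ := fun x => f₂ (-x))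
      (fun x hx => by
        have h := (hf (-x) (hsub x hx)).scomp x (hasDerivAt_neg x)
        simpa [Function.comp_def] using h)
      (fun x hx => by
        have h := ((hf₁ (-x) (hsub x hx)).scomp x (hasDerivAt_neg x)).fun_neg
        simpa [Function.comp_def] using h)
      (hf₂.comp continuousOn_neg hsub)
      (by simpa using hneg c ⟨hc.1, le_rfl⟩)
      (fun x hx => hlb _ (hsub x hx))
    rw [intervalIntegral.integral_comp_neg (fun x => cis (f x))] at this
    simpa using this
  · intro c hc hpos
    have hsub : Set.Icc c b ⊆ Set.Icc a b := Set.Icc_subset_Icc_left hc.1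
    exact van_der_corput_second_right hc.2 hμ (fun x hx => hf x (hsub hx))
      (fun x hx => hf₁ x (hsub hx)) (hf₂.mono hsub) (hpos c ⟨le_rfl, hc.2⟩)
      (fun x hx => hlb x (hsub hx))

lemma norm_integral_cis_neg (a b : ℝ) (f : ℝ → ℝ) :
    ‖∫ x in a..b, cis (-f x)‖ = ‖∫ x in a..b, cis (f x)‖ := by
  have : ∫ x in a..b, cis (-f x) = (starRingEnd ℂ) (∫ x in a..b, cis (f x)) := by
    simp_rw [← conj_cis]
    rw [intervalIntegral, intervalIntegral, map_sub, integral_conj, integral_conj]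
  rw [this, RCLike.norm_conj]

/-- Second-derivative van der Corput estimate with either sign of the second derivative and an
amplitude of bounded variation. -/
lemma van_der_corput_amplitude {a b μ : ℝ} (hab : a ≤ b) (hμ : 0 < μ) {f f₁ f₂ : ℝ → ℝ}
    (hf : ∀ x ∈ Set.Icc a b, HasDerivAt f (f₁ x) x)
    (hf₁ : ∀ x ∈ Set.Icc a b, HasDerivAt f₁ (f₂ x) x) (hf₂ : ContinuousOn f₂ (Set.Icc a b))
    (hlb : (∀ x ∈ Set.Icc a b, μ ≤ f₂ x) ∨ ∀ x ∈ Set.Icc a b, f₂ x ≤ -μ)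
    {ψ ψ' : ℝ → ℂ} {V v : ℝ → ℝ}
    (hψ : ∀ x ∈ Set.Icc a b, HasDerivAt ψ (ψ' x) x) (hψ' : ContinuousOn ψ' (Set.Icc a b))
    (hV : ∀ x ∈ Set.Icc a b, HasDerivAt V (v x) x) (hv : ContinuousOn v (Set.Icc a b))
    (hle : ∀ x ∈ Set.Icc a b, ‖ψ' x‖ ≤ v x) :
    ‖∫ x in a..b, cis (f x) * ψ x‖ ≤ 6 / √μ * (‖ψ b‖ + (V b - V a)) := by
  have hfc : ContinuousOn f (Set.Icc a b) := fun x hx => (hf x hx).continuousAt.continuousWithinAt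
  refine norm_integral_mul_le_of_primitive hab hfc.cis hψ hψ' hV hv hle fun x hx => ?_
  have hsub : Set.Icc a x ⊆ Set.Icc a b := Set.Icc_subset_Icc_right hx.2
  rcases hlb with hlb | hlb
  · exact van_der_corput_second hx.1 hμ (fun y hy => hf y (hsub hy))
      (fun y hy => hf₁ y (hsub hy)) (hf₂.mono hsub) (fun y hy => hlb y (hsub hy))
  · rw [← norm_integral_cis_neg]
    exact van_der_corput_second hx.1 hμ (fun y hy => (hf y (hsub hy)).neg)
      (fun y hy => (hf₁ y (hsub hy)).neg) (hf₂.mono hsub).neg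
      (fun y hy => by have := hlb y (hsub hy); linarith)

/-- A regularization of the odd kernel `1 / s`. -/
noncomputable def oddKernel (ε s : ℝ) : ℝ := s / (s ^ 2 + ε ^ 2)

lemma oddKernel_neg (ε s : ℝ) : oddKernel ε (-s) = -oddKernel ε s := by
  simp [oddKernel, neg_div]

lemma continuous_oddKernel {ε : ℝ} (hε : 0 < ε) : Continuous (oddKernel ε) := by
  unfold oddKernel
  exact continuous_id.div (by fun_prop) fun s => by positivity

lemma continuous_oddKernel_ofReal {ε : ℝ} (hε : 0 < ε) :
    Continuous (fun s => (oddKernel ε s : ℂ)) :=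
  Complex.continuous_ofReal.comp (continuous_oddKernel hε)

lemma abs_mul_oddKernel_le (ε s : ℝ) : |s| * |oddKernel ε s| ≤ 1 := by
  rw [← abs_mul, oddKernel, mul_div_assoc', abs_div, ← sq, abs_of_nonneg (sq_nonneg s),
    abs_of_nonneg (by positivity)]
  exact div_le_one_of_le₀ (by nlinarith [sq_nonneg ε]) (by positivity)

lemma hasDerivAt_oddKernel {ε : ℝ} (hε : 0 < ε) (s : ℝ) :
    HasDerivAt (oddKernel ε) ((ε ^ 2 - s ^ 2) / (s ^ 2 + ε ^ 2) ^ 2) s := by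
  have h := (hasDerivAt_id s).div (((hasDerivAt_id s).pow 2).add_const (ε ^ 2))
    (by change s ^ 2 + ε ^ 2 ≠ 0; positivity)
  refine h.congr_deriv ?_
  congr 1
  norm_num
  ring

lemma norm_integral_mul_oddKernel_le {ε h A K : ℝ} (hε : 0 < ε) (hh : 0 < h) (hA : h ≤ A)
    {g : ℝ → ℂ} (hg : ContinuousOn g (Set.Icc h A))
    (hK : ∀ x ∈ Set.Icc h A, ‖∫ y in h..x, g y‖ ≤ K) :
    ‖∫ s in h..A, g s * oddKernel ε s‖ ≤ K / h := by
  have hK0 : 0 ≤ K := (norm_nonneg _).trans (hK h ⟨le_rfl, hA⟩)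
  have hpos : ∀ x ∈ Set.Icc h A, 0 < x := fun x hx => hh.trans_le hx.1
  have key := norm_integral_mul_le_of_primitive (K := K) hA hg
    (ψ := fun s => (oddKernel ε s : ℂ))
    (ψ' := fun s => (((ε ^ 2 - s ^ 2) / (s ^ 2 + ε ^ 2) ^ 2 : ℝ) : ℂ))
    (V := fun s => -s⁻¹) (v := fun s => (s ^ 2)⁻¹)
    (fun x _ => (hasDerivAt_oddKernel hε x).ofReal_comp)
    (Continuous.continuousOn (Complex.continuous_ofReal.comp
      (Continuous.div (by fun_prop) (by fun_prop) fun s => by positivity)))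
    (fun x hx => by
      refine (hasDerivAt_inv (hpos x hx).ne').neg.congr_deriv ?_
      ring)
    (ContinuousOn.inv₀ (by fun_prop) fun x hx => (pow_pos (hpos x hx) 2).ne')
    (fun x hx => by
      have hx0 := hpos x hx
      rw [Complex.norm_real, Real.norm_eq_abs, abs_div, abs_of_nonneg (by positivity :
        0 ≤ (x ^ 2 + ε ^ 2) ^ 2), inv_eq_one_div, div_le_div_iff₀ (by positivity) (by positivity)]
      have h1 : |ε ^ 2 - x ^ 2| ≤ x ^ 2 + ε ^ 2 := abs_le.2 ⟨by nlinarith, by nlinarith⟩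
      have h2 : |ε ^ 2 - x ^ 2| * x ^ 2 ≤ (x ^ 2 + ε ^ 2) * (x ^ 2 + ε ^ 2) := by
        gcongr
        nlinarith
      linarith)
    hK
  refine key.trans ?_
  rw [div_eq_mul_inv]
  gcongr
  have hA0 := hh.trans_le hA
  have h1 := abs_mul_oddKernel_le ε A
  rw [abs_of_pos hA0] at h1
  have h2 : |oddKernel ε A| ≤ A⁻¹ := by
    rw [inv_eq_one_div, le_div_iff₀ hA0]; linarith
  rw [Complex.norm_real, Real.norm_eq_abs]
  linarith

lemma integral_mul_oddKernel_reflect {ε h A : ℝ} (g : ℝ → ℂ) :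
    ∫ s in (-A)..(-h), g s * oddKernel ε s = -∫ s in h..A, g (-s) * oddKernel ε s := by
  rw [← intervalIntegral.integral_comp_neg (fun s => g s * oddKernel ε s),
    ← intervalIntegral.integral_neg]
  simp [oddKernel_neg]

lemma norm_integral_symm_le {ε h A : ℝ} (hε : 0 < ε) (hh : 0 ≤ h) (hA : h ≤ A)
    {g : ℝ → ℂ} (hg : ContinuousOn g (Set.Icc (-A) A)) :
    ‖∫ s in (-A)..A, g s * oddKernel ε s‖ ≤ ‖∫ s in (-h)..h, g s * oddKernel ε s‖ +
      ‖∫ s in h..A, g s * oddKernel ε s‖ + ‖∫ s in h..A, g (-s) * oddKernel ε s‖ := by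
  have hi : ∀ x y, -A ≤ x → x ≤ y → y ≤ A →
      IntervalIntegrable (fun s => g s * oddKernel ε s) volume x y := by
    intro x y h1 h2 h3
    refine ContinuousOn.intervalIntegrable ?_
    rw [Set.uIcc_of_le h2]
    exact (hg.mono (Set.Icc_subset_Icc h1 h3)).mul (continuous_oddKernel_ofReal hε).continuousOn
  rw [← intervalIntegral.integral_add_adjacent_intervals
      (hi (-A) (-h) le_rfl (by linarith) (by linarith)) (hi (-h) A (by linarith) (by linarith) le_rfl),
    ← intervalIntegral.integral_add_adjacent_intervals
      (hi (-h) h (by linarith) (by linarith) hA) (hi h A (by linarith) hA le_rfl),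
    integral_mul_oddKernel_reflect]
  refine (norm_add_le _ _).trans ?_
  rw [norm_neg]
  have := norm_add_le (∫ s in (-h)..h, g s * oddKernel ε s) (∫ s in h..A, g s * oddKernel ε s)
  linarith

lemma norm_integral_compare_le {ε h E : ℝ} (hε : 0 < ε) (hh : 0 ≤ h) {g g' : ℝ → ℂ}
    (hg : ContinuousOn g (Set.Icc (-h) h)) (hg' : ContinuousOn g' (Set.Icc (-h) h))
    (hE : ∀ s ∈ Set.Icc (-h) h, ‖g s - g' s‖ ≤ E * |s|) (hE0 : 0 ≤ E) :
    ‖∫ s in (-h)..h, g s * oddKernel ε s‖ ≤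
      ‖∫ s in (-h)..h, g' s * oddKernel ε s‖ + 2 * h * E := by
  have hu : Set.uIcc (-h) h = Set.Icc (-h) h := Set.uIcc_of_le (by linarith)
  have hk := (continuous_oddKernel_ofReal hε).continuousOn (s := Set.Icc (-h) h)
  have h1 : ∫ s in (-h)..h, g s * oddKernel ε s = (∫ s in (-h)..h, g' s * oddKernel ε s) +
      ∫ s in (-h)..h, (g s - g' s) * oddKernel ε s := by
    rw [← intervalIntegral.integral_add]
    · refine intervalIntegral.integral_congr fun s _ => ?_
      ring
    · exact ContinuousOn.intervalIntegrable (hu ▸ hg'.mul hk)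
    · exact ContinuousOn.intervalIntegrable (hu ▸ (hg.sub hg').mul hk)
  rw [h1]
  refine (norm_add_le _ _).trans (add_le_add le_rfl ?_)
  have h2 := intervalIntegral.norm_integral_le_of_norm_le_const (a := -h) (b := h) (C := E)
    (f := fun s => (g s - g' s) * oddKernel ε s) (fun s hs => by
      rw [Set.uIoc_of_le (by linarith)] at hs
      rw [norm_mul, Complex.norm_real, Real.norm_eq_abs]
      calc ‖g s - g' s‖ * |oddKernel ε s| ≤ E * |s| * |oddKernel ε s| := by
            gcongr; exact hE s (Set.Ioc_subset_Icc_self hs)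
        _ = E * (|s| * |oddKernel ε s|) := by ring
        _ ≤ E * 1 := by gcongr; exact abs_mul_oddKernel_le ε s
        _ = E := mul_one E)
  rw [abs_of_nonneg (by linarith)] at h2
  linarith

lemma integral_oddKernel_symm (ε h : ℝ) : ∫ s in (-h)..h, (1 : ℂ) * oddKernel ε s = 0 := by
  have h1 := intervalIntegral.integral_comp_neg (a := -h) (b := h)
    (fun s => (1 : ℂ) * oddKernel ε s)
  simp only [oddKernel_neg, neg_neg, Complex.ofReal_neg, mul_neg,
    intervalIntegral.integral_neg] at h1
  exact self_eq_neg.1 h1.symm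

lemma norm_integral_cis_linear_le {a x y : ℝ} (ha : a ≠ 0) :
    ‖∫ s in x..y, cis (a * s)‖ ≤ 2 / |a| := by
  have hd : ∀ s, HasDerivAt (fun s => cis (a * s) * ((a : ℂ)⁻¹ * -Complex.I)) (cis (a * s)) s := by
    intro s
    have ha' : (a : ℂ) ≠ 0 := by exact_mod_cast ha
    have h := (((hasDerivAt_id s).const_mul a).cis).mul_const ((a : ℂ)⁻¹ * -Complex.I)
    refine h.congr_deriv ?_
    simp only [id, mul_one]
    field_simp
    simp
  have hc : Continuous (fun s => cis (a * s)) := continuous_cis.comp (by fun_prop)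
  rw [intervalIntegral.integral_eq_sub_of_hasDerivAt (fun s _ => hd s)
    (hc.intervalIntegrable _ _)]
  refine (norm_sub_le _ _).trans ?_
  simp only [norm_mul, norm_cis, norm_inv, Complex.norm_real, norm_neg, Complex.norm_I, one_mul,
    mul_one, Real.norm_eq_abs]
  rw [div_eq_mul_inv]
  linarith

lemma norm_integral_linear_oddKernel_le {ε A : ℝ} (hε : 0 < ε) (hA : 0 < A) (a : ℝ) :
    ‖∫ s in (-A)..A, cis (a * s) * oddKernel ε s‖ ≤ 6 := by
  have hc : ∀ a : ℝ, Continuous (fun s => cis (a * s)) := fun a =>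
    continuous_cis.comp (by fun_prop)
  have inner : ∀ h, 0 ≤ h → |a| * h ≤ 1 →
      ‖∫ s in (-h)..h, cis (a * s) * oddKernel ε s‖ ≤ 2 := by
    intro h hh hah
    have := norm_integral_compare_le (E := |a|) hε hh (hc a).continuousOn
      (g' := fun _ => 1) continuousOn_const (fun s _ => by
        have := norm_cis_sub_cis_le (a * s) 0
        rwa [cis_zero, sub_zero, abs_mul] at this) (abs_nonneg a)
    rw [integral_oddKernel_symm, norm_zero] at this
    linarith
  rcases le_total (|a| * A) 1 with h1 | h1
  · linarith [inner A hA.le h1]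
  have ha : a ≠ 0 := by
    rintro rfl
    norm_num at h1
  have ha' : 0 < |a| := abs_pos.2 ha
  have hA' : |a|⁻¹ ≤ A := by rw [inv_le_iff_one_le_mul₀' ha']; exact h1
  have hs := norm_integral_symm_le hε (inv_pos.2 ha').le hA' (hc a).continuousOn
  have hin := inner |a|⁻¹ (inv_pos.2 ha').le (mul_inv_cancel₀ ha'.ne').le
  have hout : ∀ a' : ℝ, |a'| = |a| →
      ‖∫ s in |a|⁻¹..A, cis (a' * s) * oddKernel ε s‖ ≤ 2 := by
    intro a' haa
    have := norm_integral_mul_oddKernel_le (K := 2 / |a|) hε (inv_pos.2 ha') hA'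
      (hc a').continuousOn (fun x _ => by
        rw [← haa]
        exact norm_integral_cis_linear_le (abs_pos.1 (haa ▸ ha')))
    refine this.trans_eq ?_
    field_simp
  have e : ∀ s, cis (a * -s) = cis (-a * s) := fun s => by rw [mul_neg, neg_mul]
  simp only [e] at hs
  linarith [hout a rfl, hout (-a) (abs_neg a)]

lemma norm_integral_quadratic_oddKernel_le {ε A : ℝ} (hε : 0 < ε) (hA : 0 < A) (a b : ℝ) :
    ‖∫ s in (-A)..A, cis (a * s + b * s ^ 2) * oddKernel ε s‖ ≤ 20 := by
  have hc : ∀ a : ℝ, Continuous (fun s => cis (a * s + b * s ^ 2)) := fun a =>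
    continuous_cis.comp (by fun_prop)
  have inner : ∀ h, 0 < h → |b| * h ^ 2 ≤ 1 →
      ‖∫ s in (-h)..h, cis (a * s + b * s ^ 2) * oddKernel ε s‖ ≤ 8 := by
    intro h hh hbh
    have := norm_integral_compare_le (E := |b| * h) hε hh.le (hc a).continuousOn
      (g' := fun s => cis (a * s)) (continuous_cis.comp (by fun_prop)).continuousOn
      (fun s hs => by
        refine (norm_cis_sub_cis_le _ _).trans ?_
        have : a * s + b * s ^ 2 - a * s = b * (s * s) := by ring
        rw [this, abs_mul, abs_mul, mul_assoc]
        gcongr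
        exact abs_le.2 hs) (by positivity)
    have h2 := norm_integral_linear_oddKernel_le hε hh a
    have h3 : 2 * h * (|b| * h) = 2 * (|b| * h ^ 2) := by ring
    linarith
  rcases le_total (|b| * A ^ 2) 1 with h1 | h1
  · linarith [inner A hA h1]
  have hb : b ≠ 0 := by
    rintro rfl
    norm_num at h1
  have hb' : 0 < |b| := abs_pos.2 hb
  have hr : 0 < √|b| := Real.sqrt_pos.2 hb'
  have hrr : √|b| ^ 2 = |b| := Real.sq_sqrt hb'.le
  have hA' : (√|b|)⁻¹ ≤ A := by
    rw [inv_le_iff_one_le_mul₀' hr, ← abs_of_pos (mul_pos hr hA), ← one_le_sq_iff_one_le_abs,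
      mul_pow, hrr]
    exact h1
  have hs := norm_integral_symm_le hε (inv_pos.2 hr).le hA' (hc a).continuousOn
  have hin := inner (√|b|)⁻¹ (inv_pos.2 hr) (by rw [inv_pow, hrr, mul_inv_cancel₀ hb'.ne'])
  have hout : ∀ a' : ℝ,
      ‖∫ s in (√|b|)⁻¹..A, cis (a' * s + b * s ^ 2) * oddKernel ε s‖ ≤ 6 := by
    intro a'
    have := norm_integral_mul_oddKernel_le (K := 6 / √|b|) hε (inv_pos.2 hr) hA'
      (hc a').continuousOn (fun x hx => by
        have hv := van_der_corput_amplitude hx.1 hb'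
          (f := fun s => a' * s + b * s ^ 2) (f₁ := fun s => a' + b * (2 * s))
          (f₂ := fun _ => b * 2)
          (fun s _ => by
            have := ((hasDerivAt_id s).const_mul a').add (((hasDerivAt_id s).pow 2).const_mul b)
            refine this.congr_deriv ?_
            simp)
          (fun s _ => by
            have := ((((hasDerivAt_id s).const_mul 2)).const_mul b).const_add a'
            refine this.congr_deriv ?_
            simp)
          continuousOn_const
          (by
            rcases le_total 0 b with h | h
            · left; intro _ _; rw [abs_of_nonneg h]; linarith
            · right; intro _ _; rw [abs_of_nonpos h]; linarith)
          (ψ := fun _ => 1) (ψ' := fun _ => 0) (V := fun _ => 0) (v := fun _ => 0)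
          (fun s _ => hasDerivAt_const s 1) continuousOn_const
          (fun s _ => hasDerivAt_const s 0) continuousOn_const (fun s _ => by simp)
        simpa using hv)
    refine this.trans_eq ?_
    field_simp
  have e : ∀ s, cis (a * -s + b * (-s) ^ 2) = cis (-a * s + b * s ^ 2) := fun s => by
    congr 1; ring
  simp only [e] at hs
  linarith [hout a, hout (-a)]

/-- Oscillatory integrals over `[A, c]` with third derivative of size at least `m`, at distance
at least `m ^ (-1 / 3)` from the singularity of the kernel. -/
lemma norm_integral_cubic_outer_le {ε m A c : ℝ} (hε : 0 < ε) (hA : 0 < A)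
    (hm : m * A ^ 3 = 1) (hc : A ≤ c) {f f₁ f₂ f₃ : ℝ → ℝ}
    (hf : ∀ x ∈ Set.Icc A c, HasDerivAt f (f₁ x) x)
    (hf₁ : ∀ x ∈ Set.Icc A c, HasDerivAt f₁ (f₂ x) x)
    (hf₂ : ∀ x ∈ Set.Icc A c, HasDerivAt f₂ (f₃ x) x)
    (hlb : ∀ x ∈ Set.Icc A c, m ≤ f₃ x) :
    ‖∫ s in A..c, cis (f s) * oddKernel ε s‖ ≤ 14 := by
  have hA3 : 0 < A ^ 3 := by positivity
  have hm0 : 0 < m := by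
    by_contra h
    have := mul_nonpos_of_nonpos_of_nonneg (not_lt.1 h) hA3.le
    linarith
  have hμ : 0 < m * A := by positivity
  have hsq : √(m * A) = A⁻¹ := by
    rw [Real.sqrt_eq_iff_mul_self_eq hμ.le (by positivity)]
    field_simp
    linarith
  have hfc : ContinuousOn f (Set.Icc A c) := fun x hx => (hf x hx).continuousAt.continuousWithinAt
  have hf₂c : ContinuousOn f₂ (Set.Icc A c) := fun x hx =>
    (hf₂ x hx).continuousAt.continuousWithinAt
  have slope : ∀ x ∈ Set.Icc A c, ∀ y ∈ Set.Icc A c, x ≤ y → m * (y - x) ≤ f₂ y - f₂ x :=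
    (convex_Icc A c).mul_sub_le_image_sub_of_le_deriv hf₂c
      (fun y hy => (hf₂ y (interior_subset hy)).differentiableAt.differentiableWithinAt)
      (fun y hy => by rw [(hf₂ y (interior_subset hy)).deriv]; exact hlb y (interior_subset hy))
  have hmono : MonotoneOn f₂ (Set.Icc A c) := fun x hx y hy hxy => by
    have := slope x hx y hy hxy
    nlinarith
  have hFc : ContinuousOn (fun s => cis (f s) * (oddKernel ε s : ℂ)) (Set.Icc A c) :=
    hfc.cis.mul (continuous_oddKernel_ofReal hε).continuousOn
  have curved : ∀ x y, A ≤ x → x ≤ y → y ≤ c →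
      ((∀ z ∈ Set.Icc x y, m * A ≤ f₂ z) ∨ ∀ z ∈ Set.Icc x y, f₂ z ≤ -(m * A)) →
      ‖∫ s in x..y, cis (f s) * oddKernel ε s‖ ≤ 6 := by
    intro x y h1 h2 h3 h4
    have hsub : Set.Icc x y ⊆ Set.Icc A c := Set.Icc_subset_Icc h1 h3
    have hx0 : 0 < x := hA.trans_le h1
    have := norm_integral_mul_oddKernel_le (K := 6 * A) hε hx0 h2 (hfc.mono hsub).cis
      (fun z hz => by
        have hsub' : Set.Icc x z ⊆ Set.Icc x y := Set.Icc_subset_Icc_right hz.2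
        have hv := van_der_corput_amplitude hz.1 hμ
          (fun w hw => hf w (hsub (hsub' hw))) (fun w hw => hf₁ w (hsub (hsub' hw)))
          (hf₂c.mono (hsub'.trans hsub))
          (h4.imp (fun h w hw => h w (hsub' hw)) (fun h w hw => h w (hsub' hw)))
          (ψ := fun _ => 1) (ψ' := fun _ => 0) (V := fun _ => 0) (v := fun _ => 0)
          (fun s _ => hasDerivAt_const s 1) continuousOn_const
          (fun s _ => hasDerivAt_const s 0) continuousOn_const (fun s _ => by simp)
        rw [hsq] at hv
        simpa using hv)
    refine this.trans ?_
    rw [div_le_iff₀ hx0]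
    linarith
  have e14 : (14 : ℝ) = 6 + (2 + 6) := by norm_num
  rw [e14]
  refine norm_integral_le_of_monotone_split (f := fun s => f₂ s + m * A) hc
    (fun x hx y hy hxy => by simpa using hmono hx hy hxy)
    (hf₂c.add continuousOn_const) hFc (by norm_num) (by norm_num) ?_ ?_
  · intro p hp hneg
    exact curved A p le_rfl hp.1 hp.2 (Or.inr fun z hz => by linarith [hneg z hz])
  · intro p hp hpos
    have hsub : Set.Icc p c ⊆ Set.Icc A c := Set.Icc_subset_Icc_left hp.1
    refine norm_integral_le_of_monotone_split (f := fun s => f₂ s - m * A) hp.2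
      (fun x hx y hy hxy => by simpa using hmono (hsub hx) (hsub hy) hxy)
      ((hf₂c.mono hsub).sub continuousOn_const) (hFc.mono hsub) (by norm_num) (by norm_num) ?_ ?_
    · intro q hq hneg
      have h1 := slope p hp q (hsub hq) hq.1
      have h2 := hpos p ⟨le_rfl, hp.2⟩
      have h3 := hneg q ⟨hq.1, le_rfl⟩
      have h4 : q - p ≤ 2 * A := by
        have : m * (q - p) ≤ m * (2 * A) := by linarith
        exact le_of_mul_le_mul_left this hm0
      have h5 := intervalIntegral.norm_integral_le_of_norm_le_const (a := p) (b := q)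
        (C := A⁻¹) (f := fun s => cis (f s) * (oddKernel ε s : ℂ)) (fun s hs => by
          rw [Set.uIoc_of_le hq.1] at hs
          have hAs : A ≤ s := hp.1.trans hs.1.le
          have h6 := abs_mul_oddKernel_le ε s
          rw [abs_of_pos (hA.trans_le hAs)] at h6
          rw [norm_mul, norm_cis, one_mul, Complex.norm_real, Real.norm_eq_abs, inv_eq_one_div,
            le_div_iff₀ hA]
          nlinarith [abs_nonneg (oddKernel ε s)])
      rw [abs_of_nonneg (sub_nonneg.2 hq.1)] at h5
      refine h5.trans ?_
      rw [inv_mul_le_iff₀ hA]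
      linarith
    · intro q hq hpos'
      exact curved q c (hp.1.trans hq.1) hq.2 le_rfl
        (Or.inl fun z hz => by linarith [hpos' z hz])

lemma norm_integral_cis_neg_mul_ofReal (a b : ℝ) (f k : ℝ → ℝ) :
    ‖∫ x in a..b, cis (-f x) * (k x : ℂ)‖ = ‖∫ x in a..b, cis (f x) * (k x : ℂ)‖ := by
  have : ∫ x in a..b, cis (-f x) * (k x : ℂ)
      = (starRingEnd ℂ) (∫ x in a..b, cis (f x) * (k x : ℂ)) := by
    rw [intervalIntegral, intervalIntegral, map_sub, ← integral_conj, ← integral_conj]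
    simp [conj_cis]
  rw [this, RCLike.norm_conj]

/-- A uniform bound for singular oscillatory integrals whose phase has third derivative comparable
to an arbitrary positive number. -/
lemma norm_integral_cubic_oddKernel_le {ε m M c : ℝ} (hε : 0 < ε) (hm : 0 < m) (hM : 0 ≤ M)
    (hc : 0 < c) {f f₁ f₂ f₃ : ℝ → ℝ}
    (hf : ∀ x ∈ Set.Icc (-c) c, HasDerivAt f (f₁ x) x)
    (hf₁ : ∀ x ∈ Set.Icc (-c) c, HasDerivAt f₁ (f₂ x) x)
    (hf₂ : ∀ x ∈ Set.Icc (-c) c, HasDerivAt f₂ (f₃ x) x)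
    (hlb : ∀ x ∈ Set.Icc (-c) c, m ≤ f₃ x) (hub : ∀ x ∈ Set.Icc (-c) c, f₃ x ≤ M * m) :
    ‖∫ s in (-c)..c, cis (f s) * oddKernel ε s‖ ≤ 48 + 2 * M := by
  have hfc : ContinuousOn f (Set.Icc (-c) c) := fun x hx =>
    (hf x hx).continuousAt.continuousWithinAt
  have taylor : ∀ s ∈ Set.Icc (-c) c,
      |f s - (f 0 + f₁ 0 * s + f₂ 0 / 2 * s ^ 2)| ≤ M * m * |s| ^ 3 := by
    intro s hs
    have hs' : |s| ≤ c := abs_le.2 hs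
    have hJ : Set.Icc (-|s|) |s| ⊆ Set.Icc (-c) c := Set.Icc_subset_Icc (by linarith) hs'
    have h0 : (0 : ℝ) ∈ Set.Icc (-|s|) |s| := ⟨by simp, by simp⟩
    have hss : s ∈ Set.Icc (-|s|) |s| := ⟨neg_abs_le s, le_abs_self s⟩
    have b2 : ∀ z ∈ Set.Icc (-|s|) |s|, |f₂ z - f₂ 0| ≤ M * m * |s| := by
      intro z hz
      have := (convex_Icc (-|s|) |s|).norm_image_sub_le_of_norm_hasDerivWithin_le
        (fun y hy => (hf₂ y (hJ hy)).hasDerivWithinAt)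
        (fun y hy => by
          rw [Real.norm_of_nonneg (hm.le.trans (hlb y (hJ hy)))]; exact hub y (hJ hy)) h0 hz
      rw [sub_zero, Real.norm_eq_abs, Real.norm_eq_abs] at this
      exact this.trans (mul_le_mul_of_nonneg_left (abs_le.2 hz) (by positivity))
    have b1 : ∀ z ∈ Set.Icc (-|s|) |s|, |f₁ z - f₂ 0 * z - f₁ 0| ≤ M * m * |s| ^ 2 := by
      intro z hz
      have := (convex_Icc (-|s|) |s|).norm_image_sub_le_of_norm_hasDerivWithin_le
        (f := fun z => f₁ z - f₂ 0 * z) (f' := fun z => f₂ z - f₂ 0)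
        (fun y hy => by
          have := (hf₁ y (hJ hy)).fun_sub ((hasDerivAt_id y).const_mul (f₂ 0))
          simpa using this.hasDerivWithinAt)
        b2 h0 hz
      simp only [mul_zero, sub_zero, Real.norm_eq_abs] at this
      refine this.trans ?_
      have : |z| ≤ |s| := abs_le.2 hz
      calc M * m * |s| * |z| ≤ M * m * |s| * |s| := by gcongr
        _ = _ := by ring
    have := (convex_Icc (-|s|) |s|).norm_image_sub_le_of_norm_hasDerivWithin_le
        (f := fun z => f z - f₁ 0 * z - f₂ 0 / 2 * z ^ 2)
        (f' := fun z => f₁ z - f₂ 0 * z - f₁ 0)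
        (fun y hy => by
          have := ((hf y (hJ hy)).sub ((hasDerivAt_id y).const_mul (f₁ 0))).sub
            (((hasDerivAt_id y).pow 2).const_mul (f₂ 0 / 2))
          refine HasDerivAt.hasDerivWithinAt (this.congr_deriv ?_)
          simp
          ring)
        b1 h0 hss
    simp only [mul_zero, sub_zero, Real.norm_eq_abs] at this
    have e : f s - (f 0 + f₁ 0 * s + f₂ 0 / 2 * s ^ 2)
        = f s - f₁ 0 * s - f₂ 0 / 2 * s ^ 2 - (f 0 - f₂ 0 / 2 * 0 ^ 2) := by ring
    rw [e]
    refine this.trans_eq ?_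
    ring
  have inner : ∀ h, 0 < h → h ≤ c → m * h ^ 3 ≤ 1 →
      ‖∫ s in (-h)..h, cis (f s) * oddKernel ε s‖ ≤ 20 + 2 * M := by
    intro h hh hhc hmh
    have hsub : Set.Icc (-h) h ⊆ Set.Icc (-c) c := Set.Icc_subset_Icc (by linarith) hhc
    have h1 := norm_integral_compare_le (E := M * m * h ^ 2) hε hh.le (hfc.mono hsub).cis
      (g' := fun s => cis (f 0) * cis (f₁ 0 * s + f₂ 0 / 2 * s ^ 2))
      (continuous_const.mul (continuous_cis.comp (by fun_prop))).continuousOn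
      (fun s hs => by
        rw [← cis_add, ← add_assoc]
        refine (norm_cis_sub_cis_le _ _).trans ((taylor s (hsub hs)).trans ?_)
        have : |s| ≤ h := abs_le.2 hs
        calc M * m * |s| ^ 3 = M * m * |s| ^ 2 * |s| := by ring
          _ ≤ M * m * h ^ 2 * |s| := by gcongr) (by positivity)
    have h2 : ‖∫ s in (-h)..h, cis (f 0) * cis (f₁ 0 * s + f₂ 0 / 2 * s ^ 2) *
        oddKernel ε s‖ ≤ 20 := by
      simp_rw [mul_assoc]
      rw [intervalIntegral.integral_const_mul, norm_mul, norm_cis, one_mul]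
      exact norm_integral_quadratic_oddKernel_le hε hh _ _
    have h3 : 2 * h * (M * m * h ^ 2) ≤ 2 * M := by
      have : 2 * h * (M * m * h ^ 2) = 2 * M * (m * h ^ 3) := by ring
      rw [this]
      exact mul_le_of_le_one_right (by positivity) hmh
    linarith
  rcases le_total (m * c ^ 3) 1 with h1 | h1
  · linarith [inner c hc le_rfl h1]
  obtain ⟨A, hA, hA1⟩ : ∃ A ∈ Set.Icc 0 c, m * A ^ 3 = 1 :=
    intermediate_value_Icc hc.le (f := fun A => m * A ^ 3) (by fun_prop) ⟨by simp, h1⟩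
  have hA0 : 0 < A := by
    rcases hA.1.eq_or_lt with h | h
    · rw [← h] at hA1; norm_num at hA1
    · exact h
  have hs := norm_integral_symm_le hε hA0.le hA.2 hfc.cis
  have hin := inner A hA0 hA.2 hA1.le
  have hr : Set.Icc A c ⊆ Set.Icc (-c) c := Set.Icc_subset_Icc_left (by linarith)
  have hl : ∀ x ∈ Set.Icc A c, -x ∈ Set.Icc (-c) c := fun x hx =>
    ⟨by linarith [hx.2], by linarith [hx.1]⟩
  have o1 := norm_integral_cubic_outer_le hε hA0 hA1 hA.2 (fun x hx => hf x (hr hx))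
    (fun x hx => hf₁ x (hr hx)) (fun x hx => hf₂ x (hr hx)) (fun x hx => hlb x (hr hx))
  have o2 := norm_integral_cubic_outer_le hε hA0 hA1 hA.2
    (f := fun x => -f (-x)) (f₁ := fun x => f₁ (-x)) (f₂ := fun x => -f₂ (-x))
    (f₃ := fun x => f₃ (-x))
    (fun x hx => by
      have h := ((hf (-x) (hl x hx)).scomp x (hasDerivAt_neg x)).fun_neg
      simpa [Function.comp_def] using h)
    (fun x hx => by
      have h := ((hf₁ (-x) (hl x hx)).scomp x (hasDerivAt_neg x))
      simpa [Function.comp_def] using h)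
    (fun x hx => by
      have h := ((hf₂ (-x) (hl x hx)).scomp x (hasDerivAt_neg x)).fun_neg
      simpa [Function.comp_def] using h)
    (fun x hx => hlb _ (hl x hx))
  rw [norm_integral_cis_neg_mul_ofReal] at o2
  linarith

/-- Second-derivative van der Corput estimate for an amplitude whose variation is controlled by
that of the arctangent of a monotone function. -/
lemma van_der_corput_arctan {a b μ A B : ℝ} (hab : a ≤ b) (hab1 : b - a ≤ 1) (hμ : 0 < μ)
    (hB : 0 ≤ B) {f f₁ f₂ : ℝ → ℝ}
    (hf : ∀ x ∈ Set.Icc a b, HasDerivAt f (f₁ x) x)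
    (hf₁ : ∀ x ∈ Set.Icc a b, HasDerivAt f₁ (f₂ x) x) (hf₂ : ContinuousOn f₂ (Set.Icc a b))
    (hlb : (∀ x ∈ Set.Icc a b, μ ≤ f₂ x) ∨ ∀ x ∈ Set.Icc a b, f₂ x ≤ -μ)
    {ψ ψ' : ℝ → ℂ} {ρ ρ' : ℝ → ℝ}
    (hψ : ∀ x ∈ Set.Icc a b, HasDerivAt ψ (ψ' x) x) (hψ' : ContinuousOn ψ' (Set.Icc a b))
    (hρ : ∀ x ∈ Set.Icc a b, HasDerivAt ρ (ρ' x) x) (hρ' : ContinuousOn ρ' (Set.Icc a b))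
    (hs : (∀ x ∈ Set.Icc a b, 0 ≤ ρ' x) ∨ ∀ x ∈ Set.Icc a b, ρ' x ≤ 0)
    (hle : ∀ x ∈ Set.Icc a b, ‖ψ' x‖ ≤ B * (|ρ' x| / (1 + ρ x ^ 2) + 1)) (hA : ‖ψ b‖ ≤ A) :
    ‖∫ x in a..b, cis (f x) * ψ x‖ ≤ 6 / √μ * (A + 5 * B) := by
  have hρc : ContinuousOn ρ (Set.Icc a b) := fun x hx => (hρ x hx).continuousAt.continuousWithinAt
  have key : ∀ e : ℝ, e = 1 ∨ e = -1 → (∀ x ∈ Set.Icc a b, |ρ' x| = e * ρ' x) →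
      ‖∫ x in a..b, cis (f x) * ψ x‖ ≤ 6 / √μ * (A + 5 * B) := by
    intro e he habs
    have h := van_der_corput_amplitude hab hμ hf hf₁ hf₂ hlb hψ hψ'
      (V := fun x => B * (e * Real.arctan (ρ x) + x))
      (v := fun x => B * (e * (1 / (1 + ρ x ^ 2) * ρ' x) + 1))
      (fun x hx => ((((hρ x hx).arctan).const_mul e).fun_add (hasDerivAt_id x)).const_mul B)
      (continuousOn_const.mul ((continuousOn_const.mul ((continuousOn_const.div
        (continuousOn_const.add (hρc.pow 2)) fun x _ => by
          change 1 + ρ x ^ 2 ≠ 0; positivity).mul hρ')).add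
        continuousOn_const))
      (fun x hx => (hle x hx).trans_eq (by rw [habs x hx]; ring))
    refine h.trans (mul_le_mul_of_nonneg_left (add_le_add hA ?_) (by positivity))
    have h1 := Real.arctan_lt_pi_div_two (ρ b)
    have h2 := Real.arctan_lt_pi_div_two (ρ a)
    have h3 := Real.neg_pi_div_two_lt_arctan (ρ b)
    have h4 := Real.neg_pi_div_two_lt_arctan (ρ a)
    have h5 := Real.pi_lt_d2
    have : e * Real.arctan (ρ b) - e * Real.arctan (ρ a) ≤ 4 := by
      rcases he with rfl | rfl <;> linarith
    nlinarith
  rcases hs with hs | hs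
  · exact key 1 (Or.inl rfl) fun x hx => by rw [abs_of_nonneg (hs x hx), one_mul]
  · exact key (-1) (Or.inr rfl) fun x hx => by rw [abs_of_nonpos (hs x hx)]; ring

/-- The truncated Fresnel integral. -/
noncomputable def fresnel (s : ℝ) : ℂ := ∫ u in (0 : ℝ)..s, cis (-3 * u ^ 2)

/-- The truncated Fresnel integral minus a regularisation of its leading oscillating term. -/
noncomputable def fresnelReg (s : ℝ) : ℂ :=
  fresnel s - Complex.I / 6 * ((s / (s ^ 2 + 1) : ℝ) * cis (-3 * s ^ 2))

/-- The derivative of `fresnelReg`. -/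
noncomputable def fresnelReg' (s : ℝ) : ℂ :=
  cis (-3 * s ^ 2) * ((1 / (s ^ 2 + 1) : ℝ) -
    Complex.I / 6 * ((1 - s ^ 2) / (s ^ 2 + 1) ^ 2 : ℝ))

lemma continuous_cis_sq : Continuous fun u : ℝ => cis (-3 * u ^ 2) :=
  continuous_cis.comp (by fun_prop)

lemma hasDerivAt_fresnel (s : ℝ) : HasDerivAt fresnel (cis (-3 * s ^ 2)) s :=
  intervalIntegral.integral_hasDerivAt_right (continuous_cis_sq.intervalIntegrable _ _)
    (continuous_cis_sq.stronglyMeasurableAtFilter _ _) continuous_cis_sq.continuousAt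

lemma hasDerivAt_fresnelReg (s : ℝ) : HasDerivAt fresnelReg (fresnelReg' s) s := by
  have h1 : HasDerivAt (fun s : ℝ => s / (s ^ 2 + 1)) ((1 - s ^ 2) / (s ^ 2 + 1) ^ 2) s := by
    have := hasDerivAt_oddKernel one_pos s
    unfold oddKernel at this
    simpa using this
  have h2 : HasDerivAt (fun s : ℝ => -3 * s ^ 2) (-6 * s) s := by
    refine ((hasDerivAt_pow 2 s).const_mul (-3)).congr_deriv ?_
    norm_num
    ring
  have h := (hasDerivAt_fresnel s).sub ((h1.ofReal_comp.mul h2.cis).const_mul (Complex.I / 6))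
  refine h.congr_deriv ?_
  have h3 : ((s : ℂ) ^ 2 + 1) ≠ 0 := by
    have : (s ^ 2 + 1 : ℝ) ≠ 0 := by positivity
    exact_mod_cast this
  simp only [fresnelReg']
  push_cast
  field_simp
  ring_nf
  simp only [Complex.I_sq]
  ring

lemma norm_fresnelReg'_le (s : ℝ) : ‖fresnelReg' s‖ ≤ 7 / 6 * (1 / (1 + s ^ 2)) := by
  rw [fresnelReg', norm_mul, norm_cis, one_mul]
  refine (norm_sub_le _ _).trans ?_
  rw [norm_mul, Complex.norm_real, Complex.norm_real, norm_div Complex.I, Complex.norm_I,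
    Real.norm_of_nonneg (by positivity), Real.norm_eq_abs, abs_div, abs_of_pos (a := (s ^ 2 + 1) ^ 2)
    (by positivity)]
  have h : |1 - s ^ 2| / (s ^ 2 + 1) ^ 2 ≤ 1 / (s ^ 2 + 1) := by
    rw [div_le_div_iff₀ (by positivity) (by positivity)]
    have : |1 - s ^ 2| ≤ s ^ 2 + 1 := abs_le.2 ⟨by nlinarith, by nlinarith⟩
    nlinarith [sq_nonneg s]
  have e : (1 : ℝ) / (1 + s ^ 2) = 1 / (s ^ 2 + 1) := by rw [add_comm]
  rw [e]
  have h6 : ‖(6 : ℂ)‖ = 6 := by simp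
  rw [h6]
  linarith

lemma continuous_fresnelReg' : Continuous fresnelReg' := by
  have h : ∀ s : ℝ, s ^ 2 + 1 ≠ 0 := fun s => by positivity
  have h' : ∀ s : ℝ, (s ^ 2 + 1) ^ 2 ≠ 0 := fun s => by positivity
  refine continuous_cis_sq.mul (Continuous.sub (Complex.continuous_ofReal.comp ?_)
    (continuous_const.mul (Complex.continuous_ofReal.comp ?_)))
  · exact continuous_const.div (by fun_prop) h
  · exact Continuous.div (by fun_prop) (by fun_prop) h'

lemma norm_fresnelReg_le (s : ℝ) : ‖fresnelReg s‖ ≤ 2 := by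
  have h0 : fresnelReg 0 = 0 := by simp [fresnelReg, fresnel]
  have h1 : ∫ u in (0 : ℝ)..s, fresnelReg' u = fresnelReg s := by
    rw [intervalIntegral.integral_eq_sub_of_hasDerivAt (fun x _ => hasDerivAt_fresnelReg x)
      (continuous_fresnelReg'.intervalIntegrable _ _), h0, sub_zero]
  have h2 := intervalIntegral.norm_integral_le_abs_of_norm_le (a := 0) (b := s) (μ := volume)
    (f := fresnelReg') (g := fun u => 7 / 6 * (1 / (1 + u ^ 2)))
    (Filter.Eventually.of_forall fun u => norm_fresnelReg'_le u)
    (Continuous.intervalIntegrable (continuous_const.mul (continuous_const.div (by fun_prop)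
      fun x => by positivity)) _ _)
  rw [h1, intervalIntegral.integral_const_mul, integral_one_div_one_add_sq, Real.arctan_zero,
    sub_zero, abs_mul] at h2
  refine h2.trans ?_
  have h3 := Real.arctan_lt_pi_div_two s
  have h4 := Real.neg_pi_div_two_lt_arctan s
  have h5 := Real.pi_lt_d2
  have : |Real.arctan s| ≤ 1.6 := abs_le.2 ⟨by linarith, by linarith⟩
  rw [abs_of_pos (by norm_num : (0 : ℝ) < 7 / 6)]
  linarith

/-- The amplitude `ρ / (ρ² + ξ)` of the boundary terms is bounded. -/
lemma abs_boundaryAmp_le {ρ ξ : ℝ} (hξ : 1 / 2 ≤ ξ) : |ρ / (ρ ^ 2 + ξ)| ≤ 1 := by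
  rw [abs_div, abs_of_pos (a := ρ ^ 2 + ξ) (by positivity)]
  refine div_le_one_of_le₀ ?_ (by positivity)
  nlinarith [sq_nonneg (|ρ| - 1 / 2), sq_abs ρ]

lemma abs_boundaryAmp_le_inv {ρ ξ d : ℝ} (hξ : 1 / 2 ≤ ξ) (hd : 0 < d) (h : d ≤ |ρ|) :
    |ρ / (ρ ^ 2 + ξ)| ≤ 1 / d := by
  rw [abs_div, abs_of_pos (a := ρ ^ 2 + ξ) (by positivity), div_le_div_iff₀ (by positivity) hd]
  nlinarith [sq_abs ρ]

/-- Van der Corput estimate with the boundary amplitude. -/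
lemma van_der_corput_boundary {a b μ : ℝ} (ha : 1 / 2 ≤ a) (hab : a ≤ b) (hb : b ≤ 1) (hμ : 0 < μ)
    {f f₁ f₂ ρ ρ' : ℝ → ℝ}
    (hf : ∀ x ∈ Set.Icc a b, HasDerivAt f (f₁ x) x)
    (hf₁ : ∀ x ∈ Set.Icc a b, HasDerivAt f₁ (f₂ x) x) (hf₂ : ContinuousOn f₂ (Set.Icc a b))
    (hlb : (∀ x ∈ Set.Icc a b, μ ≤ f₂ x) ∨ ∀ x ∈ Set.Icc a b, f₂ x ≤ -μ)
    (hρ : ∀ x ∈ Set.Icc a b, HasDerivAt ρ (ρ' x) x) (hρ' : ContinuousOn ρ' (Set.Icc a b))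
    (hs : (∀ x ∈ Set.Icc a b, 0 ≤ ρ' x) ∨ ∀ x ∈ Set.Icc a b, ρ' x ≤ 0) :
    ‖∫ x in a..b, cis (f x) * (ρ x / (ρ x ^ 2 + x) : ℝ)‖ ≤ 66 / √μ := by
  have hρc : ContinuousOn ρ (Set.Icc a b) := fun x hx => (hρ x hx).continuousAt.continuousWithinAt
  have hden : ∀ x ∈ Set.Icc a b, 0 < ρ x ^ 2 + x := fun x hx => by
    have : 0 < x := by linarith [hx.1]
    positivity
  have h := van_der_corput_arctan hab (by linarith) hμ (A := 1) (B := 2) (by norm_num) hf hf₁ hf₂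
    hlb (ψ := fun x => (ρ x / (ρ x ^ 2 + x) : ℝ))
    (ψ' := fun x => ((ρ' x * (ρ x ^ 2 + x) - ρ x * (2 * ρ x * ρ' x + 1)) / (ρ x ^ 2 + x) ^ 2 : ℝ))
    (fun x hx => by
      have h1 := (hρ x hx).fun_div (((hρ x hx).fun_pow 2).fun_add (hasDerivAt_id x))
        (hden x hx).ne'
      refine HasDerivAt.ofReal_comp (h1.congr_deriv ?_)
      simp)
    (Complex.continuous_ofReal.comp_continuousOn (ContinuousOn.div (by fun_prop) (by fun_prop)
      fun x hx => pow_ne_zero 2 (hden x hx).ne')) hρ hρ' hs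
    (fun x hx => ?_) ?_
  · refine h.trans_eq (by ring)
  · have hd := hden x hx
    have hx1 : 1 / 2 ≤ x := ha.trans hx.1
    rw [Complex.norm_real, Real.norm_eq_abs]
    have e : (ρ' x * (ρ x ^ 2 + x) - ρ x * (2 * ρ x * ρ' x + 1)) / (ρ x ^ 2 + x) ^ 2 =
        ρ' x * ((x - ρ x ^ 2) / (ρ x ^ 2 + x) ^ 2) - (ρ x / (ρ x ^ 2 + x)) * (1 / (ρ x ^ 2 + x)) := by
      field_simp
      ring
    rw [e]
    refine (abs_sub _ _).trans ?_
    rw [abs_mul, abs_mul, mul_add, mul_one]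
    refine add_le_add ?_ ?_
    · rw [mul_div_assoc', mul_comm 2, mul_div_assoc]
      refine mul_le_mul_of_nonneg_left ?_ (abs_nonneg _)
      rw [abs_div, abs_of_pos (a := (ρ x ^ 2 + x) ^ 2) (by positivity),
        div_le_div_iff₀ (by positivity) (by positivity)]
      have : |x - ρ x ^ 2| ≤ ρ x ^ 2 + x := abs_le.2 ⟨by nlinarith, by nlinarith⟩
      calc |x - ρ x ^ 2| * (1 + ρ x ^ 2) ≤ (ρ x ^ 2 + x) * (2 * (ρ x ^ 2 + x)) := by
            refine mul_le_mul this ?_ (by positivity) hd.le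
            nlinarith [sq_nonneg (ρ x)]
        _ = _ := by ring
    · have h1 : |1 / (ρ x ^ 2 + x)| ≤ 2 := by
        rw [abs_of_pos (by positivity), div_le_iff₀ hd]
        nlinarith [sq_nonneg (ρ x)]
      have h2 := abs_boundaryAmp_le (ρ := ρ x) hx1
      nlinarith [abs_nonneg (ρ x / (ρ x ^ 2 + x)), abs_nonneg (1 / (ρ x ^ 2 + x))]
  · rw [Complex.norm_real]
    exact abs_boundaryAmp_le (ha.trans hab)

/-- Van der Corput estimate with the amplitude `ξ^{-1/2} N(ρ ξ^{-1/2})`, `N = fresnelReg`. -/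
lemma van_der_corput_fresnelReg {a b μ : ℝ} (ha : 1 / 2 ≤ a) (hab : a ≤ b) (hb : b ≤ 1)
    (hμ : 0 < μ) {f f₁ f₂ ρ ρ' : ℝ → ℝ}
    (hf : ∀ x ∈ Set.Icc a b, HasDerivAt f (f₁ x) x)
    (hf₁ : ∀ x ∈ Set.Icc a b, HasDerivAt f₁ (f₂ x) x) (hf₂ : ContinuousOn f₂ (Set.Icc a b))
    (hlb : (∀ x ∈ Set.Icc a b, μ ≤ f₂ x) ∨ ∀ x ∈ Set.Icc a b, f₂ x ≤ -μ)
    (hρ : ∀ x ∈ Set.Icc a b, HasDerivAt ρ (ρ' x) x) (hρ' : ContinuousOn ρ' (Set.Icc a b))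
    (hs : (∀ x ∈ Set.Icc a b, 0 ≤ ρ' x) ∨ ∀ x ∈ Set.Icc a b, ρ' x ≤ 0) :
    ‖∫ x in a..b, cis (f x) * ((1 / √x : ℝ) * fresnelReg (ρ x / √x))‖ ≤ 200 / √μ := by
  have hρc : ContinuousOn ρ (Set.Icc a b) := fun x hx => (hρ x hx).continuousAt.continuousWithinAt
  have hpos : ∀ x ∈ Set.Icc a b, 0 < x := fun x hx => by linarith [hx.1]
  have hσ : ∀ x ∈ Set.Icc a b, 0 < √x := fun x hx => Real.sqrt_pos.2 (hpos x hx)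
  have hσ' : ∀ x ∈ Set.Icc a b, 1 / √x ≤ 3 / 2 := fun x hx => by
    rw [div_le_iff₀ (hσ x hx)]
    have : (2 / 3 : ℝ) ≤ √x := Real.le_sqrt_of_sq_le (by linarith [hx.1])
    linarith
  have hsc : ContinuousOn (fun x : ℝ => √x) (Set.Icc a b) := Real.continuous_sqrt.continuousOn
  have hdσ : ∀ x ∈ Set.Icc a b, HasDerivAt (fun x : ℝ => 1 / √x) (-(1 / (2 * √x)) / √x ^ 2) x := by
    intro x hx
    have := ((Real.hasDerivAt_sqrt (hpos x hx).ne').fun_inv (hσ x hx).ne')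
    simpa only [one_div] using this
  have hdq : ∀ x ∈ Set.Icc a b, HasDerivAt (fun x => ρ x / √x)
      ((ρ' x * √x - ρ x * (1 / (2 * √x))) / √x ^ 2) x := fun x hx =>
    (hρ x hx).fun_div (Real.hasDerivAt_sqrt (hpos x hx).ne') (hσ x hx).ne'
  have hqc : ContinuousOn (fun x => ρ x / √x) (Set.Icc a b) := fun x hx =>
    (hdq x hx).continuousAt.continuousWithinAt
  have hN : Continuous fresnelReg := continuous_iff_continuousAt.2 fun s =>
    (hasDerivAt_fresnelReg s).continuousAt
  have h := van_der_corput_arctan hab (by linarith) hμ (A := 3) (B := 6) (by norm_num) hf hf₁ hf₂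
    hlb (ψ := fun x => (1 / √x : ℝ) * fresnelReg (ρ x / √x))
    (ψ' := fun x => (-(1 / (2 * √x)) / √x ^ 2 : ℝ) * fresnelReg (ρ x / √x) + (1 / √x : ℝ) *
      (((ρ' x * √x - ρ x * (1 / (2 * √x))) / √x ^ 2 : ℝ) * fresnelReg' (ρ x / √x)))
    (fun x hx => by
      have hc := HasDerivAt.scomp x (hasDerivAt_fresnelReg (ρ x / √x)) (hdq x hx)
      rw [Complex.real_smul] at hc
      exact (hdσ x hx).ofReal_comp.mul hc)
    ?_ hρ hρ' hs (fun x hx => ?_) ?_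
  · refine h.trans ?_
    rw [div_mul_eq_mul_div]
    gcongr
    norm_num
  · have c1 : ContinuousOn (fun x : ℝ => 1 / (2 * √x)) (Set.Icc a b) :=
      continuousOn_const.div (by fun_prop) fun x hx => by have := hσ x hx; positivity
    have c2 : ContinuousOn (fun x : ℝ => 1 / √x) (Set.Icc a b) :=
      continuousOn_const.div (by fun_prop) fun x hx => (hσ x hx).ne'
    have c3 : ∀ x ∈ Set.Icc a b, √x ^ 2 ≠ 0 := fun x hx => pow_ne_zero 2 (hσ x hx).ne'
    refine ContinuousOn.add (ContinuousOn.mul (Complex.continuous_ofReal.comp_continuousOn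
      (c1.neg.div (by fun_prop) c3)) (hN.comp_continuousOn hqc)) (ContinuousOn.mul
      (Complex.continuous_ofReal.comp_continuousOn c2) (ContinuousOn.mul
      (Complex.continuous_ofReal.comp_continuousOn
        (ContinuousOn.div (by fun_prop) (by fun_prop) c3))
      (continuous_fresnelReg'.comp_continuousOn hqc)))
  · have hx0 := hpos x hx
    have hx2 : 1 / 2 ≤ x := ha.trans hx.1
    have hx1 : x ≤ 1 := hx.2.trans hb
    have hs0 := hσ x hx
    have hsq : √x ^ 2 = x := Real.sq_sqrt hx0.le
    have hs1 := hσ' x hx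
    have hsn : 0 ≤ 1 / √x := by positivity
    have e1 : -(1 / (2 * √x)) / √x ^ 2 = -((1 / √x) * (1 / x) / 2) := by
      rw [hsq]; field_simp
    have e2 : (ρ' x * √x - ρ x * (1 / (2 * √x))) / √x ^ 2 =
        (1 / √x) * (ρ' x - ρ x * (1 / x) / 2) := by
      rw [hsq]
      field_simp
      rw [hsq]
      ring
    have hinv : 1 / x ≤ 2 := by rw [div_le_iff₀ hx0]; linarith
    have hinv0 : 0 ≤ 1 / x := by positivity
    rw [e1, e2]
    refine (norm_add_le _ _).trans ?_
    rw [norm_mul, norm_mul, norm_mul, Complex.norm_real, Complex.norm_real, Complex.norm_real,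
      norm_neg, Real.norm_of_nonneg (by positivity), Real.norm_of_nonneg hsn, norm_mul,
      Real.norm_of_nonneg hsn, Real.norm_eq_abs]
    have n1 : ‖fresnelReg' (ρ x / √x)‖ ≤ 7 / 6 * (1 / (1 + ρ x ^ 2)) := by
      refine (norm_fresnelReg'_le _).trans ?_
      refine mul_le_mul_of_nonneg_left (one_div_le_one_div_of_le (by positivity)
        (add_le_add le_rfl ?_)) (by norm_num)
      rw [div_pow, hsq, le_div_iff₀ hx0]
      nlinarith [sq_nonneg (ρ x)]
    have n2 := norm_fresnelReg_le (ρ x / √x)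
    have n3 : |ρ' x - ρ x * (1 / x) / 2| ≤ |ρ' x| + |ρ x| := by
      refine (abs_sub _ _).trans (add_le_add le_rfl ?_)
      rw [abs_div, abs_mul, abs_of_nonneg hinv0, abs_of_pos (by norm_num : (0 : ℝ) < 2)]
      nlinarith [abs_nonneg (ρ x)]
    have n4 : |ρ x| * (1 / (1 + ρ x ^ 2)) ≤ 1 / 2 := by
      rw [mul_one_div, div_le_iff₀ (by positivity)]
      nlinarith [sq_nonneg (|ρ x| - 1), sq_abs (ρ x)]
    have s1 : 1 / √x * (1 / x) / 2 * ‖fresnelReg (ρ x / √x)‖ ≤ 3 / 2 * 2 / 2 * 2 := by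
      gcongr
    have s2 : 1 / √x * (1 / √x * |ρ' x - ρ x * (1 / x) / 2| * ‖fresnelReg' (ρ x / √x)‖) ≤
        3 / 2 * (3 / 2 * (|ρ' x| + |ρ x|) * (7 / 6 * (1 / (1 + ρ x ^ 2)))) := by
      gcongr
    refine (add_le_add s1 s2).trans ?_
    have n5 : 0 ≤ |ρ' x| * (1 / (1 + ρ x ^ 2)) := by positivity
    rw [div_eq_mul_one_div |ρ' x|]
    nlinarith
  · have hbm : b ∈ Set.Icc a b := ⟨hab, le_rfl⟩
    rw [norm_mul, Complex.norm_real, Real.norm_of_nonneg (by have := hσ b hbm; positivity)]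
    have := norm_fresnelReg_le (ρ b / √b)
    have := hσ' b hbm
    have := norm_nonneg (fresnelReg (ρ b / √b))
    nlinarith [hσ b hbm]

/-- The phase `k²φ(ξ,η) + xξ + 6k²Yη` restricted to the curve `η = β(ξ)`. -/
noncomputable def boundaryPhase (k x Y : ℝ) (β : ℝ → ℝ) (ξ : ℝ) : ℝ :=
  k ^ 2 * ξ ^ 3 + x * ξ - 3 * k ^ 2 * ξ * β ξ ^ 2 + 6 * k ^ 2 * Y * β ξ

/-- The oscillatory integral along the curve `η = β(ξ)` with regularised amplitude. -/
noncomputable def boundaryIntegral (k x Y : ℝ) (β : ℝ → ℝ) (a b : ℝ) : ℂ :=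
  ∫ ξ in a..b, cis (boundaryPhase k x Y β ξ) *
    (k * (ξ * β ξ - Y) / ((k * (ξ * β ξ - Y)) ^ 2 + ξ) : ℝ)

/-- The oscillatory integral over the region `0 < η < β(ξ)`, `a < ξ < b`. -/
noncomputable def stripIntegral (k x Y : ℝ) (β : ℝ → ℝ) (a b : ℝ) : ℂ :=
  ∫ ξ in a..b, ∫ η in (0 : ℝ)..β ξ,
    cis (k ^ 2 * (ξ ^ 3 - 3 * ξ * η ^ 2) + x * ξ + 6 * k ^ 2 * Y * η)

/-- The phase after completing the square in `η`. -/
noncomputable def squarePhase (k x Y ξ : ℝ) : ℝ :=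
  k ^ 2 * ξ ^ 3 + x * ξ + 3 * k ^ 2 * Y ^ 2 / ξ

lemma integral_fiber_eq {k ξ : ℝ} (hk : 0 < k) (hξ : 0 < ξ) (x Y c : ℝ) :
    (k : ℂ) * ∫ η in (0 : ℝ)..c,
      cis (k ^ 2 * (ξ ^ 3 - 3 * ξ * η ^ 2) + x * ξ + 6 * k ^ 2 * Y * η) =
    cis (squarePhase k x Y ξ) * ((1 / √ξ : ℝ) * fresnel (k * (ξ * c - Y) / √ξ)) -
    cis (squarePhase k x Y ξ) * ((1 / √ξ : ℝ) * fresnel (k * (ξ * 0 - Y) / √ξ)) := by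
  have hs : 0 < √ξ := Real.sqrt_pos.2 hξ
  have hsq : √ξ ^ 2 = ξ := Real.sq_sqrt hξ.le
  have h1 : ∀ η : ℝ, cis (k ^ 2 * (ξ ^ 3 - 3 * ξ * η ^ 2) + x * ξ + 6 * k ^ 2 * Y * η) =
      cis (squarePhase k x Y ξ) * cis (-3 * (k * √ξ * η + -(k * Y / √ξ)) ^ 2) := by
    intro η
    rw [← cis_add]
    congr 1
    have : (k * √ξ * η + -(k * Y / √ξ)) ^ 2 =
        k ^ 2 * √ξ ^ 2 * η ^ 2 - 2 * k ^ 2 * η * Y + k ^ 2 * Y ^ 2 / √ξ ^ 2 := by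
      field_simp
      ring
    rw [this, hsq, squarePhase]
    field_simp
    ring
  simp_rw [h1]
  have hks : k * √ξ ≠ 0 := (mul_pos hk hs).ne'
  have hq : ∀ c, k * (ξ * c - Y) / √ξ = k * √ξ * c + -(k * Y / √ξ) := by
    intro c
    field_simp
    rw [hsq]
    ring
  rw [intervalIntegral.integral_const_mul,
    intervalIntegral.integral_comp_mul_add (fun u => cis (-3 * u ^ 2)) hks, hq c, hq 0]
  have hint : ∀ a b, IntervalIntegrable (fun u : ℝ => cis (-3 * u ^ 2)) volume a b := fun a b =>
    continuous_cis_sq.intervalIntegrable _ _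
  rw [← intervalIntegral.integral_interval_sub_left (hint 0 _) (hint 0 _)]
  change _ * (_ * _ • (fresnel _ - fresnel _)) = _
  rw [Complex.real_smul]
  have hkc : (k : ℂ) ≠ 0 := by exact_mod_cast hk.ne'
  have hsc : (√ξ : ℂ) ≠ 0 := by exact_mod_cast hs.ne'
  push_cast
  field_simp

lemma sqrtInv_mul_fresnel {ξ : ℝ} (hξ : 0 < ξ) (k x Y : ℝ) (β : ℝ → ℝ) :
    cis (squarePhase k x Y ξ) * ((1 / √ξ : ℝ) * fresnel (k * (ξ * β ξ - Y) / √ξ)) =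
    cis (squarePhase k x Y ξ) * ((1 / √ξ : ℝ) * fresnelReg (k * (ξ * β ξ - Y) / √ξ)) +
    Complex.I / 6 * (cis (boundaryPhase k x Y β ξ) *
      (k * (ξ * β ξ - Y) / ((k * (ξ * β ξ - Y)) ^ 2 + ξ) : ℝ)) := by
  have hs : 0 < √ξ := Real.sqrt_pos.2 hξ
  have hsq : √ξ ^ 2 = ξ := Real.sq_sqrt hξ.le
  have h1 : cis (boundaryPhase k x Y β ξ) =
      cis (squarePhase k x Y ξ) * cis (-3 * (k * (ξ * β ξ - Y) / √ξ) ^ 2) := by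
    rw [← cis_add]
    congr 1
    rw [div_pow, hsq, squarePhase, boundaryPhase]
    field_simp
    ring
  have h2 : k * (ξ * β ξ - Y) / ((k * (ξ * β ξ - Y)) ^ 2 + ξ) = 1 / √ξ *
      ((k * (ξ * β ξ - Y) / √ξ) / ((k * (ξ * β ξ - Y) / √ξ) ^ 2 + 1)) := by
    generalize k * (ξ * β ξ - Y) = ρ
    have e : (ρ / √ξ) ^ 2 + 1 = (ρ ^ 2 + ξ) / √ξ ^ 2 := by rw [div_pow, hsq]; field_simp
    have : ρ ^ 2 + ξ ≠ 0 := by positivity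
    rw [e]
    field_simp
  rw [h1, h2, fresnelReg]
  push_cast
  ring

lemma norm_integral_fresnelReg_le {k a b : ℝ} (hk : 0 < k) (ha : 1 / 2 ≤ a) (hab : a ≤ b)
    (hb : b ≤ 1) (x Y : ℝ) {β β' : ℝ → ℝ} (hβ : ∀ ξ ∈ Set.Icc a b, HasDerivAt β (β' ξ) ξ)
    (hβ' : ContinuousOn β' (Set.Icc a b))
    (hs : (∀ ξ ∈ Set.Icc a b, 0 ≤ β ξ + ξ * β' ξ) ∨ ∀ ξ ∈ Set.Icc a b, β ξ + ξ * β' ξ ≤ 0) :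
    ‖∫ ξ in a..b, cis (squarePhase k x Y ξ) *
      ((1 / √ξ : ℝ) * fresnelReg (k * (ξ * β ξ - Y) / √ξ))‖ ≤ 200 / k := by
  have hβc : ContinuousOn β (Set.Icc a b) := fun x hx => (hβ x hx).continuousAt.continuousWithinAt
  have hpos : ∀ ξ ∈ Set.Icc a b, 0 < ξ := fun ξ hξ => by linarith [hξ.1]
  have h := van_der_corput_fresnelReg ha hab hb (μ := k ^ 2) (by positivity)
    (f := squarePhase k x Y) (f₁ := fun ξ => 3 * k ^ 2 * ξ ^ 2 + x - 3 * k ^ 2 * Y ^ 2 / ξ ^ 2)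
    (f₂ := fun ξ => 6 * k ^ 2 * ξ + 6 * k ^ 2 * Y ^ 2 / ξ ^ 3)
    (ρ := fun ξ => k * (ξ * β ξ - Y)) (ρ' := fun ξ => k * (β ξ + ξ * β' ξ))
    (fun ξ hξ => by
      have h0 := (hpos ξ hξ).ne'
      have := ((((hasDerivAt_pow 3 ξ).const_mul (k ^ 2)).fun_add
        ((hasDerivAt_id ξ).const_mul x)).fun_add
        ((hasDerivAt_inv h0).const_mul (3 * k ^ 2 * Y ^ 2)))
      simp only [← div_eq_mul_inv] at this
      refine this.congr_deriv ?_
      simp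
      field_simp
      ring)
    (fun ξ hξ => by
      have h0 := (hpos ξ hξ).ne'
      have := ((((hasDerivAt_pow 2 ξ).const_mul (3 * k ^ 2)).add_const x).fun_sub
        (((hasDerivAt_pow 2 ξ).fun_inv (pow_ne_zero 2 h0)).const_mul (3 * k ^ 2 * Y ^ 2)))
      simp only [← div_eq_mul_inv] at this
      refine this.congr_deriv ?_
      simp
      field_simp
      ring)
    (ContinuousOn.add (by fun_prop) (continuousOn_const.div (by fun_prop) fun ξ hξ =>
      pow_ne_zero 3 (hpos ξ hξ).ne'))
    (Or.inl fun ξ hξ => by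
      have h0 := hpos ξ hξ
      have h1 : 0 ≤ 6 * k ^ 2 * Y ^ 2 / ξ ^ 3 := by positivity
      have h2 : 1 / 2 ≤ ξ := ha.trans hξ.1
      nlinarith [sq_nonneg k])
    (fun ξ hξ => by
      have := (((hasDerivAt_id ξ).fun_mul (hβ ξ hξ)).sub_const Y).const_mul k
      refine this.congr_deriv ?_
      simp)
    (by fun_prop)
    (hs.imp (fun h ξ hξ => mul_nonneg hk.le (h ξ hξ))
      fun h ξ hξ => mul_nonpos_of_nonneg_of_nonpos hk.le (h ξ hξ))
  rwa [Real.sqrt_sq hk.le] at h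

lemma norm_boundaryIntegral_zero_le {k a b : ℝ} (hk : 0 < k) (ha : 1 / 2 ≤ a) (hab : a ≤ b)
    (hb : b ≤ 1) (x Y : ℝ) : ‖boundaryIntegral k x Y (fun _ => 0) a b‖ ≤ 66 / k := by
  have h := van_der_corput_boundary ha hab hb (μ := k ^ 2) (by positivity)
    (f := boundaryPhase k x Y fun _ => 0) (f₁ := fun ξ => 3 * k ^ 2 * ξ ^ 2 + x)
    (f₂ := fun ξ => 6 * k ^ 2 * ξ) (ρ := fun ξ => k * (ξ * 0 - Y)) (ρ' := fun _ => 0)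
    (fun ξ hξ => by
      have := (((hasDerivAt_pow 3 ξ).const_mul (k ^ 2)).fun_add ((hasDerivAt_id ξ).const_mul x))
      have e : boundaryPhase k x Y (fun _ => 0) = fun ξ => k ^ 2 * ξ ^ 3 + x * ξ := by
        funext ξ
        simp [boundaryPhase]
      rw [e]
      refine this.congr_deriv ?_
      simp
      ring)
    (fun ξ hξ => by
      have := ((hasDerivAt_pow 2 ξ).const_mul (3 * k ^ 2)).add_const x
      refine this.congr_deriv ?_
      simp
      ring)
    (by fun_prop)
    (Or.inl fun ξ hξ => by
      have h2 : 1 / 2 ≤ ξ := ha.trans hξ.1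
      nlinarith [sq_nonneg k])
    (fun ξ hξ => by simpa using hasDerivAt_const ξ (-(k * Y)))
    (by fun_prop) (Or.inl fun ξ hξ => le_rfl)
  rwa [Real.sqrt_sq hk.le] at h

/-- Reduction of an oscillatory integral over a region to a boundary integral. -/
lemma norm_stripIntegral_le {k a b : ℝ} (hk : 0 < k) (ha : 1 / 2 ≤ a) (hab : a ≤ b)
    (hb : b ≤ 1) (x Y : ℝ) {β β' : ℝ → ℝ} (hβ : ∀ ξ ∈ Set.Icc a b, HasDerivAt β (β' ξ) ξ)
    (hβ' : ContinuousOn β' (Set.Icc a b))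
    (hs : (∀ ξ ∈ Set.Icc a b, 0 ≤ β ξ + ξ * β' ξ) ∨ ∀ ξ ∈ Set.Icc a b, β ξ + ξ * β' ξ ≤ 0) :
    ‖stripIntegral k x Y β a b‖ ≤ (‖boundaryIntegral k x Y β a b‖ + 411 / k) / k := by
  have hu : Set.uIcc a b = Set.Icc a b := Set.uIcc_of_le hab
  have hpos : ∀ ξ ∈ Set.Icc a b, 0 < ξ := fun ξ hξ => by linarith [hξ.1]
  have hN : Continuous fresnelReg := continuous_iff_continuousAt.2 fun s =>
    (hasDerivAt_fresnelReg s).continuousAt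
  have hφ : ContinuousOn (squarePhase k x Y) (Set.Icc a b) :=
    ContinuousOn.add (by fun_prop) (continuousOn_const.div continuousOn_id fun ξ hξ =>
      (hpos ξ hξ).ne')
  have ic : ∀ β : ℝ → ℝ, ContinuousOn β (Set.Icc a b) → IntervalIntegrable (fun ξ =>
      cis (squarePhase k x Y ξ) * ((1 / √ξ : ℝ) * fresnelReg (k * (ξ * β ξ - Y) / √ξ)))
      volume a b := fun β hβ => by
    refine ContinuousOn.intervalIntegrable (hu ▸ ?_)
    have hs : ∀ ξ ∈ Set.Icc a b, √ξ ≠ 0 := fun ξ hξ => (Real.sqrt_pos.2 (hpos ξ hξ)).ne'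
    exact hφ.cis.mul ((Complex.continuous_ofReal.comp_continuousOn
      (continuousOn_const.div (by fun_prop) hs)).mul
      (hN.comp_continuousOn (ContinuousOn.div (by fun_prop) (by fun_prop) hs)))
  have ib : ∀ β : ℝ → ℝ, ContinuousOn β (Set.Icc a b) → IntervalIntegrable (fun ξ =>
      Complex.I / 6 * (cis (boundaryPhase k x Y β ξ) *
      (k * (ξ * β ξ - Y) / ((k * (ξ * β ξ - Y)) ^ 2 + ξ) : ℝ))) volume a b := fun β hβ => by
    refine ContinuousOn.intervalIntegrable (hu ▸ ?_)
    refine continuousOn_const.mul ((ContinuousOn.cis ?_).mul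
      (Complex.continuous_ofReal.comp_continuousOn (ContinuousOn.div (by fun_prop) (by fun_prop)
      fun ξ hξ => ?_)))
    · unfold boundaryPhase
      fun_prop
    · have := hpos ξ hξ
      positivity
  have hβc : ContinuousOn β (Set.Icc a b) := fun x hx => (hβ x hx).continuousAt.continuousWithinAt
  have key : (k : ℂ) * stripIntegral k x Y β a b =
      ((∫ ξ in a..b, cis (squarePhase k x Y ξ) *
        ((1 / √ξ : ℝ) * fresnelReg (k * (ξ * β ξ - Y) / √ξ))) +
        Complex.I / 6 * boundaryIntegral k x Y β a b) -
      ((∫ ξ in a..b, cis (squarePhase k x Y ξ) *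
        ((1 / √ξ : ℝ) * fresnelReg (k * (ξ * 0 - Y) / √ξ))) +
        Complex.I / 6 * boundaryIntegral k x Y (fun _ => 0) a b) := by
    have z := continuousOn_const (c := (0 : ℝ)) (s := Set.Icc a b)
    rw [stripIntegral, boundaryIntegral, boundaryIntegral,
      ← intervalIntegral.integral_const_mul, ← intervalIntegral.integral_const_mul,
      ← intervalIntegral.integral_const_mul, ← intervalIntegral.integral_add (ic β hβc) (ib β hβc),
      ← intervalIntegral.integral_add (ic (fun _ => 0) z) (ib (fun _ => 0) z),
      ← intervalIntegral.integral_sub ((ic β hβc).add (ib β hβc))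
        ((ic (fun _ => 0) z).add (ib (fun _ => 0) z))]
    refine intervalIntegral.integral_congr fun ξ hξ => ?_
    have h0 := hpos ξ (hu ▸ hξ)
    change (k : ℂ) * _ = _
    rw [integral_fiber_eq hk h0, sqrtInv_mul_fresnel h0 k x Y β,
      sqrtInv_mul_fresnel h0 k x Y fun _ => 0]
  have n1 := norm_integral_fresnelReg_le hk ha hab hb x Y hβ hβ' hs
  have n2 := norm_integral_fresnelReg_le hk ha hab hb x Y (β := fun _ => 0) (β' := fun _ => 0)
    (fun ξ _ => hasDerivAt_const ξ 0) (by fun_prop) (Or.inl fun ξ _ => by simp)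
  have n3 := norm_boundaryIntegral_zero_le hk ha hab hb x Y
  have hI : ‖Complex.I / 6‖ = 1 / 6 := by simp
  have h := congrArg norm key
  rw [norm_mul, Complex.norm_real, Real.norm_of_nonneg hk.le] at h
  rw [le_div_iff₀ hk, mul_comm, h]
  refine (norm_sub_le _ _).trans ((add_le_add (norm_add_le _ _) (norm_add_le _ _)).trans ?_)
  rw [norm_mul, norm_mul, hI]
  have h4 : 411 / k = 200 / k + 200 / k + (1 / 6) * (66 / k) := by ring
  rw [h4]
  linarith [norm_nonneg (boundaryIntegral k x Y β a b)]

lemma norm_stripIntegral_line_le {k : ℝ} (hk : 0 < k) (x Y : ℝ) :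
    ‖stripIntegral k x Y (fun ξ => √3 * ξ) (1 / 2) 1‖ ≤ 477 / k ^ 2 := by
  have h3 : √3 ^ 2 = 3 := Real.sq_sqrt (by norm_num)
  have h30 : 0 ≤ √3 := Real.sqrt_nonneg 3
  have hs := norm_stripIntegral_le hk (a := 1 / 2) (b := 1) le_rfl (by norm_num) le_rfl x Y
    (β := fun ξ => √3 * ξ) (β' := fun _ => √3)
    (fun ξ _ => by simpa using (hasDerivAt_id ξ).const_mul √3) (by fun_prop)
    (Or.inl fun ξ hξ => by have : 0 ≤ ξ := by linarith [hξ.1]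
                           positivity)
  have e : boundaryPhase k x Y (fun ξ => √3 * ξ) =
      fun ξ => -8 * k ^ 2 * ξ ^ 3 + (x + 6 * k ^ 2 * Y * √3) * ξ := by
    funext ξ
    rw [boundaryPhase, mul_pow, h3]
    ring
  have h := van_der_corput_boundary (a := 1 / 2) (b := 1) le_rfl (by norm_num) le_rfl (μ := k ^ 2)
    (by positivity) (f := boundaryPhase k x Y fun ξ => √3 * ξ)
    (f₁ := fun ξ => -24 * k ^ 2 * ξ ^ 2 + (x + 6 * k ^ 2 * Y * √3))
    (f₂ := fun ξ => -48 * k ^ 2 * ξ) (ρ := fun ξ => k * (ξ * (√3 * ξ) - Y))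
    (ρ' := fun ξ => k * (2 * √3 * ξ))
    (fun ξ hξ => by
      rw [e]
      refine (((hasDerivAt_pow 3 ξ).const_mul (-8 * k ^ 2)).fun_add
        ((hasDerivAt_id ξ).const_mul (x + 6 * k ^ 2 * Y * √3))).congr_deriv ?_
      simp
      ring)
    (fun ξ hξ => by
      refine (((hasDerivAt_pow 2 ξ).const_mul (-24 * k ^ 2)).add_const _).congr_deriv ?_
      simp
      ring)
    (by fun_prop)
    (Or.inr fun ξ hξ => by
      have h2 : 1 / 2 ≤ ξ := hξ.1
      nlinarith [sq_nonneg k])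
    (fun ξ hξ => by
      have := (((hasDerivAt_id ξ).fun_mul ((hasDerivAt_id ξ).const_mul √3)).sub_const Y).const_mul k
      refine this.congr_deriv ?_
      simp only [id]
      ring)
    (by fun_prop) (Or.inl fun ξ hξ => by have : 0 ≤ ξ := by linarith [hξ.1]
                                         positivity)
  rw [Real.sqrt_sq hk.le] at h
  refine hs.trans ?_
  rw [sq, ← div_div]
  gcongr
  refine (add_le_add h le_rfl).trans_eq ?_
  ring

/-- The arc of the unit circle in the upper half plane. -/
noncomputable def arc (ξ : ℝ) : ℝ := √(1 - ξ ^ 2)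

lemma arc_sq {ξ : ℝ} (h0 : 0 ≤ ξ) (h1 : ξ ≤ 1) : arc ξ ^ 2 = 1 - ξ ^ 2 :=
  Real.sq_sqrt (by nlinarith)

lemma arc_nonneg (ξ : ℝ) : 0 ≤ arc ξ := Real.sqrt_nonneg _

lemma arc_pos {ξ : ℝ} (h0 : 0 ≤ ξ) (h1 : ξ < 1) : 0 < arc ξ := Real.sqrt_pos.2 (by nlinarith)

lemma arc_le_one (ξ : ℝ) : arc ξ ≤ 1 := Real.sqrt_le_one.2 (by nlinarith [sq_nonneg ξ])

lemma continuous_arc : Continuous arc := by unfold arc; fun_prop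

lemma hasDerivAt_arc {ξ : ℝ} (h0 : 0 ≤ ξ) (h1 : ξ < 1) : HasDerivAt arc (-ξ / arc ξ) ξ := by
  have h := ((hasDerivAt_pow 2 ξ).const_sub 1).sqrt (by nlinarith)
  refine h.congr_deriv ?_
  have := (arc_pos h0 h1).ne'
  unfold arc at this ⊢
  norm_num
  field_simp

lemma hasDerivAt_arc' {ξ : ℝ} (h0 : 0 ≤ ξ) (h1 : ξ < 1) :
    HasDerivAt (fun ξ => -ξ / arc ξ) (-1 / arc ξ ^ 3) ξ := by
  have hp := arc_pos h0 h1
  refine ((hasDerivAt_neg ξ).fun_div (hasDerivAt_arc h0 h1) hp.ne').congr_deriv ?_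
  have := arc_sq h0 h1.le
  field_simp
  rw [this]
  ring

lemma hasDerivAt_arc'' {ξ : ℝ} (h0 : 0 ≤ ξ) (h1 : ξ < 1) :
    HasDerivAt (fun ξ => -1 / arc ξ ^ 3) (-3 * ξ / arc ξ ^ 5) ξ := by
  have hp := arc_pos h0 h1
  refine ((hasDerivAt_const ξ (-1)).fun_div ((hasDerivAt_arc h0 h1).fun_pow 3)
    (pow_ne_zero 3 hp.ne')).congr_deriv ?_
  field_simp
  norm_num
  ring

/-- The phase `k²φ(ξ,η) + xξ + 6k²Yη` on the arc. -/
noncomputable def arcPhase (k x Y ξ : ℝ) : ℝ :=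
  k ^ 2 * (4 * ξ ^ 3 - 3 * ξ) + x * ξ + 6 * k ^ 2 * Y * arc ξ

/-- The first derivative of `arcPhase`. -/
noncomputable def arcPhase' (k x Y ξ : ℝ) : ℝ :=
  k ^ 2 * (12 * ξ ^ 2 - 3) + x + 6 * k ^ 2 * Y * (-ξ / arc ξ)

/-- The second derivative of `arcPhase`. -/
noncomputable def arcPhase'' (k Y ξ : ℝ) : ℝ :=
  24 * k ^ 2 * ξ + 6 * k ^ 2 * Y * (-1 / arc ξ ^ 3)

/-- The third derivative of `arcPhase`. -/
noncomputable def arcPhase''' (k Y ξ : ℝ) : ℝ :=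
  24 * k ^ 2 + 6 * k ^ 2 * Y * (-3 * ξ / arc ξ ^ 5)

lemma hasDerivAt_arcPhase (k x Y : ℝ) {ξ : ℝ} (h0 : 0 ≤ ξ) (h1 : ξ < 1) :
    HasDerivAt (arcPhase k x Y) (arcPhase' k x Y ξ) ξ := by
  refine ((((((hasDerivAt_pow 3 ξ).const_mul 4).fun_sub ((hasDerivAt_id ξ).const_mul 3)).const_mul
    (k ^ 2)).fun_add ((hasDerivAt_id ξ).const_mul x)).fun_add
    ((hasDerivAt_arc h0 h1).const_mul (6 * k ^ 2 * Y))).congr_deriv ?_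
  rw [arcPhase']
  push_cast
  ring

lemma hasDerivAt_arcPhase' (k x Y : ℝ) {ξ : ℝ} (h0 : 0 ≤ ξ) (h1 : ξ < 1) :
    HasDerivAt (arcPhase' k x Y) (arcPhase'' k Y ξ) ξ := by
  refine ((((((hasDerivAt_pow 2 ξ).const_mul 12).sub_const 3).const_mul
    (k ^ 2)).add_const x).fun_add
    ((hasDerivAt_arc' h0 h1).const_mul (6 * k ^ 2 * Y))).congr_deriv ?_
  rw [arcPhase'']
  norm_num
  ring

lemma hasDerivAt_arcPhase'' (k Y : ℝ) {ξ : ℝ} (h0 : 0 ≤ ξ) (h1 : ξ < 1) :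
    HasDerivAt (arcPhase'' k Y) (arcPhase''' k Y ξ) ξ := by
  refine (((hasDerivAt_id ξ).const_mul (24 * k ^ 2)).fun_add
    ((hasDerivAt_arc'' h0 h1).const_mul (6 * k ^ 2 * Y))).congr_deriv ?_
  rw [arcPhase''']
  norm_num

/-- The derivative of `ξ ↦ ξ * arc ξ`. -/
noncomputable def mulArc' (ξ : ℝ) : ℝ := arc ξ + ξ * (-ξ / arc ξ)

lemma hasDerivAt_mulArc {ξ : ℝ} (h0 : 0 ≤ ξ) (h1 : ξ < 1) :
    HasDerivAt (fun ξ => ξ * arc ξ) (mulArc' ξ) ξ := by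
  refine ((hasDerivAt_id ξ).fun_mul (hasDerivAt_arc h0 h1)).congr_deriv ?_
  simp [mulArc']

lemma mulArc'_eq {ξ : ℝ} (h0 : 0 ≤ ξ) (h1 : ξ < 1) : mulArc' ξ = (1 - 2 * ξ ^ 2) / arc ξ := by
  have := arc_pos h0 h1
  have h := arc_sq h0 h1.le
  rw [mulArc']
  field_simp
  rw [h]
  ring

lemma continuousOn_mulArc' {a c : ℝ} (ha : 0 ≤ a) (hc : c < 1) :
    ContinuousOn mulArc' (Set.Icc a c) := by
  refine continuous_arc.continuousOn.add (continuousOn_id.mul (continuousOn_id.neg.div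
    continuous_arc.continuousOn fun ξ hξ => ?_))
  exact (arc_pos (ha.trans hξ.1) (hξ.2.trans_lt hc)).ne'

/-- The boundary integral along the arc. -/
noncomputable def arcIntegrand (k x Y ξ : ℝ) : ℂ :=
  cis (arcPhase k x Y ξ) * (k * (ξ * arc ξ - Y) / ((k * (ξ * arc ξ - Y)) ^ 2 + ξ) : ℝ)

lemma boundaryIntegral_arc {a b : ℝ} (ha : 0 ≤ a) (hab : a ≤ b) (hb : b ≤ 1) (k x Y : ℝ) :
    boundaryIntegral k x Y arc a b = ∫ ξ in a..b, arcIntegrand k x Y ξ := by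
  refine intervalIntegral.integral_congr fun ξ hξ => ?_
  rw [Set.uIcc_of_le hab] at hξ
  have h := arc_sq (ha.trans hξ.1) (hξ.2.trans hb)
  have e : boundaryPhase k x Y arc ξ = arcPhase k x Y ξ := by
    rw [boundaryPhase, arcPhase, h]
    ring
  simp only [arcIntegrand, e]

lemma continuousOn_arcIntegrand {a b : ℝ} (ha : 1 / 2 ≤ a) (k x Y : ℝ) :
    ContinuousOn (arcIntegrand k x Y) (Set.Icc a b) := by
  have hc := continuous_arc
  refine ContinuousOn.mul (ContinuousOn.cis ?_) (Complex.continuous_ofReal.comp_continuousOn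
    (ContinuousOn.div (by fun_prop) (by fun_prop) fun ξ hξ => ?_))
  · unfold arcPhase
    fun_prop
  · have : 0 < ξ := by linarith [hξ.1]
    positivity

lemma norm_arcIntegrand_le {k ξ d : ℝ} (hk : 0 < k) (hξ : 1 / 2 ≤ ξ) (hd : 0 < d) (x Y : ℝ)
    (h : d ≤ |ξ * arc ξ - Y|) : ‖arcIntegrand k x Y ξ‖ ≤ 1 / (d * k) := by
  rw [arcIntegrand, norm_mul, norm_cis, one_mul, Complex.norm_real, Real.norm_eq_abs]
  refine abs_boundaryAmp_le_inv hξ (by positivity) ?_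
  rw [abs_mul, abs_of_pos hk, mul_comm]
  gcongr

lemma norm_integral_arc_le_of_large {k a c d : ℝ} (hk : 0 < k) (ha : 1 / 2 ≤ a) (hac : a ≤ c)
    (hc : c ≤ 1) (hd : 0 < d) (x Y : ℝ) (h : ∀ ξ ∈ Set.Icc a c, d ≤ |ξ * arc ξ - Y|) :
    ‖∫ ξ in a..c, arcIntegrand k x Y ξ‖ ≤ 1 / d / k := by
  have := intervalIntegral.norm_integral_le_of_norm_le_const (a := a) (b := c) (C := 1 / (d * k))
    (f := arcIntegrand k x Y) (fun ξ hξ => by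
      rw [Set.uIoc_of_le hac] at hξ
      exact norm_arcIntegrand_le hk (ha.trans hξ.1.le) hd x Y (h ξ ⟨hξ.1.le, hξ.2⟩))
  refine this.trans ?_
  rw [div_div, abs_of_nonneg (by linarith)]
  exact mul_le_of_le_one_right (by positivity) (by linarith)

lemma norm_integral_arc_le_of_curved {k a c : ℝ} (hk : 0 < k) (ha : 1 / 2 ≤ a) (hac : a ≤ c)
    (hc : c < 1) (x Y : ℝ) (hs : 2 * c ^ 2 ≤ 1 ∨ 1 ≤ 2 * a ^ 2)
    (h : (∀ ξ ∈ Set.Icc a c, 3 / 100 * arc ξ ^ 3 ≤ 4 * ξ * arc ξ ^ 3 - Y) ∨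
      ∀ ξ ∈ Set.Icc a c, 4 * ξ * arc ξ ^ 3 - Y ≤ -(3 / 100 * arc ξ ^ 3)) :
    ‖∫ ξ in a..c, arcIntegrand k x Y ξ‖ ≤ 165 / k := by
  have h0 : ∀ ξ ∈ Set.Icc a c, 0 ≤ ξ := fun ξ hξ => by linarith [hξ.1]
  have h1 : ∀ ξ ∈ Set.Icc a c, ξ < 1 := fun ξ hξ => hξ.2.trans_lt hc
  have e : ∀ ξ ∈ Set.Icc a c, arcPhase'' k Y ξ =
      6 * k ^ 2 * ((4 * ξ * arc ξ ^ 3 - Y) / arc ξ ^ 3) := fun ξ hξ => by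
    have := arc_pos (h0 ξ hξ) (h1 ξ hξ)
    rw [arcPhase'']
    field_simp
    ring
  have hv := van_der_corput_boundary ha hac hc.le (μ := (2 / 5 * k) ^ 2) (by positivity)
    (f := arcPhase k x Y) (f₁ := arcPhase' k x Y) (f₂ := arcPhase'' k Y)
    (ρ := fun ξ => k * (ξ * arc ξ - Y)) (ρ' := fun ξ => k * mulArc' ξ)
    (fun ξ hξ => hasDerivAt_arcPhase k x Y (h0 ξ hξ) (h1 ξ hξ))
    (fun ξ hξ => hasDerivAt_arcPhase' k x Y (h0 ξ hξ) (h1 ξ hξ))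
    (fun ξ hξ => (hasDerivAt_arcPhase'' k Y (h0 ξ hξ) (h1 ξ hξ)).continuousAt.continuousWithinAt)
    (h.imp (fun h ξ hξ => by
      have hp := arc_pos (h0 ξ hξ) (h1 ξ hξ)
      have : 3 / 100 ≤ (4 * ξ * arc ξ ^ 3 - Y) / arc ξ ^ 3 := by
        rw [le_div_iff₀ (by positivity)]
        exact h ξ hξ
      rw [e ξ hξ]
      nlinarith [sq_nonneg k])
      fun h ξ hξ => by
      have hp := arc_pos (h0 ξ hξ) (h1 ξ hξ)
      have : (4 * ξ * arc ξ ^ 3 - Y) / arc ξ ^ 3 ≤ -(3 / 100) := by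
        rw [div_le_iff₀ (by positivity)]
        linarith [h ξ hξ]
      rw [e ξ hξ]
      nlinarith [sq_nonneg k])
    (fun ξ hξ => ((hasDerivAt_mulArc (h0 ξ hξ) (h1 ξ hξ)).sub_const Y).const_mul k)
    (continuousOn_const.mul (continuousOn_mulArc' (by linarith) hc))
    (hs.imp (fun hs ξ hξ => by
        rw [mulArc'_eq (h0 ξ hξ) (h1 ξ hξ)]
        refine mul_nonneg hk.le (div_nonneg ?_ (arc_nonneg ξ))
        nlinarith [hξ.2, h0 ξ hξ])
      fun hs ξ hξ => by
        rw [mulArc'_eq (h0 ξ hξ) (h1 ξ hξ)]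
        refine mul_nonpos_of_nonneg_of_nonpos hk.le (div_nonpos_of_nonpos_of_nonneg ?_
          (arc_nonneg ξ))
        nlinarith [hξ.1, h0 ξ hξ])
  rw [Real.sqrt_sq (by positivity)] at hv
  refine hv.trans_eq ?_
  field_simp
  norm_num

lemma antitoneOn_mul_arc_cube {a c : ℝ} (ha : 1 / 2 ≤ a) (hc : c < 1) :
    AntitoneOn (fun ξ => 4 * ξ * arc ξ ^ 3) (Set.Icc a c) := by
  have hd : ∀ ξ ∈ Set.Icc a c, HasDerivAt (fun ξ => 4 * ξ * arc ξ ^ 3)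
      (4 * (arc ξ * (1 - 4 * ξ ^ 2))) ξ := fun ξ hξ => by
    have h0 : 0 ≤ ξ := by linarith [hξ.1]
    have h1 : ξ < 1 := hξ.2.trans_lt hc
    refine (((hasDerivAt_id ξ).const_mul 4).fun_mul ((hasDerivAt_arc h0 h1).fun_pow 3)).congr_deriv
      ?_
    have := arc_pos h0 h1
    have h := arc_sq h0 h1.le
    simp only [id]
    field_simp
    norm_num
    rw [h]
    linear_combination (arc ξ ^ 2 + 1 - ξ ^ 2) * h
  refine antitoneOn_of_deriv_nonpos (convex_Icc a c)
    (fun ξ hξ => (hd ξ hξ).continuousAt.continuousWithinAt)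
    (fun ξ hξ => (hd ξ (interior_subset hξ)).differentiableAt.differentiableWithinAt)
    fun ξ hξ => ?_
  have hξ' := interior_subset hξ
  rw [(hd ξ hξ').deriv]
  have := hξ'.1
  have h2 : 1 - 4 * ξ ^ 2 ≤ 0 := by nlinarith
  nlinarith [mul_nonpos_of_nonneg_of_nonpos (arc_nonneg ξ) h2]

lemma antitoneOn_arc {a c : ℝ} (ha : 0 ≤ a) : AntitoneOn arc (Set.Icc a c) := fun x hx y hy hxy =>
  Real.sqrt_le_sqrt (by nlinarith [hx.1])

lemma norm_integral_arc_left_le {k a c : ℝ} (hk : 0 < k) (ha : 1 / 2 ≤ a) (hac : a ≤ c)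
    (hc : c ≤ 4 / 5) (x Y : ℝ) (hs : 2 * c ^ 2 ≤ 1 ∨ 1 ≤ 2 * a ^ 2) :
    ‖∫ ξ in a..c, arcIntegrand k x Y ξ‖ ≤ 175 / k := by
  have h175 : 175 / k = 165 / k + 10 / k := by ring
  have hcont := continuous_arc
  rw [h175]
  refine norm_integral_le_of_monotone_split hac (f := fun ξ => Y + 3 / 100 - 4 * ξ * arc ξ ^ 3)
    (fun u hu v hv huv => sub_le_sub_left
      (antitoneOn_mul_arc_cube ha (by linarith : c < 1) hu hv huv) _)
    (by fun_prop) (continuousOn_arcIntegrand ha k x Y) (by positivity) (by positivity)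
    (fun d hd h => ?_) fun d hd h => ?_
  · refine norm_integral_arc_le_of_curved hk ha hd.1 (by linarith [hd.2]) x Y
      (hs.imp (fun h => by nlinarith [hd.1, hd.2]) id) (Or.inl fun ξ hξ => ?_)
    have h1 := h ξ hξ
    have h2 : arc ξ ^ 3 ≤ 1 := pow_le_one₀ (arc_nonneg ξ) (arc_le_one ξ)
    linarith
  · refine (norm_integral_arc_le_of_large (d := 1 / 10) hk (ha.trans hd.1) hd.2 (by linarith)
      (by norm_num) x Y fun ξ hξ => ?_).trans_eq (by norm_num)
    have h1 := h ξ hξ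
    have h2 : 1 / 2 ≤ ξ := ha.trans (hd.1.trans hξ.1)
    have h3 : ξ ≤ 4 / 5 := hξ.2.trans hc
    have h4 := arc_sq (by linarith) (by linarith : ξ ≤ 1)
    have h5 : 3 / 5 ≤ arc ξ := Real.le_sqrt_of_sq_le (by nlinarith)
    have h6 : ξ * arc ξ * (1 - 4 * arc ξ ^ 2) ≤ 3 / 10 * (-11 / 25) := by
      have : 3 / 10 ≤ ξ * arc ξ := by nlinarith
      have : 1 - 4 * arc ξ ^ 2 ≤ -11 / 25 := by nlinarith
      nlinarith
    rw [abs_of_nonpos (by nlinarith)]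
    nlinarith

lemma norm_integral_arc_right_le {k a c : ℝ} (hk : 0 < k) (ha : 23 / 25 ≤ a) (hac : a ≤ c)
    (hc : c < 1) (x Y : ℝ) : ‖∫ ξ in a..c, arcIntegrand k x Y ξ‖ ≤ 181 / k := by
  have h181 : 181 / k = 16 / k + 165 / k := by ring
  have hcont := continuous_arc
  rw [h181]
  refine norm_integral_le_of_monotone_split hac
    (f := fun ξ => Y - 4 * ξ * arc ξ ^ 3 - 1 / 10 * arc ξ)
    (fun u hu v hv huv => ?_)
    (by fun_prop) (continuousOn_arcIntegrand (by linarith) k x Y) (by positivity) (by positivity)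
    (fun d hd h => ?_) fun d hd h => ?_
  · have h1 := antitoneOn_mul_arc_cube (by linarith : 1 / 2 ≤ a) hc hu hv huv
    have h2 := antitoneOn_arc (by linarith : 0 ≤ a) hu hv huv
    simp only at h1 ⊢
    linarith
  · have hb : ∀ ξ ∈ Set.Icc a d, ‖arcIntegrand k x Y ξ‖ ≤ 4 / k * (1 / arc ξ) := fun ξ hξ => by
      have h1 := h ξ hξ
      have h2 : 23 / 25 ≤ ξ := ha.trans hξ.1
      have h3 : ξ < 1 := (hξ.2.trans hd.2).trans_lt hc
      have h4 := arc_sq (by linarith) h3.le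
      have h5 := arc_pos (by linarith) h3
      have h6 : 1 / 4 * arc ξ ≤ ξ * arc ξ - Y := by
        have e : ξ * arc ξ - Y = arc ξ * (ξ * (1 - 4 * arc ξ ^ 2) - 1 / 10) -
            (Y - 4 * ξ * arc ξ ^ 3 - 1 / 10 * arc ξ) := by ring
        have : 1 / 4 ≤ ξ * (1 - 4 * arc ξ ^ 2) - 1 / 10 := by
          have : 38 / 100 ≤ 1 - 4 * arc ξ ^ 2 := by nlinarith
          nlinarith
        rw [e]
        nlinarith
      refine (norm_arcIntegrand_le hk (by linarith) (by positivity) x Y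
        (h6.trans (le_abs_self _))).trans_eq ?_
      field_simp
    have hdc : d < 1 := hd.2.trans_lt hc
    have hda : ∀ ξ ∈ Set.Icc a d, HasDerivAt Real.arcsin (1 / arc ξ) ξ := fun ξ hξ =>
      Real.hasDerivAt_arcsin (by linarith [hξ.1]) (by linarith [hξ.2])
    have hcd : ContinuousOn (fun ξ => 1 / arc ξ) (Set.uIcc a d) := by
      rw [Set.uIcc_of_le hd.1]
      exact continuousOn_const.div hcont.continuousOn fun ξ hξ =>
        (arc_pos (by linarith [hξ.1]) (hξ.2.trans_lt hdc)).ne'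
    have hi : ∫ ξ in a..d, 1 / arc ξ = Real.arcsin d - Real.arcsin a :=
      intervalIntegral.integral_eq_sub_of_hasDerivAt
        (fun ξ hξ => hda ξ (Set.uIcc_of_le hd.1 ▸ hξ)) hcd.intervalIntegrable
    have := intervalIntegral.norm_integral_le_of_norm_le hd.1 (μ := volume)
      (f := arcIntegrand k x Y) (g := fun ξ => 4 / k * (1 / arc ξ))
      (Filter.Eventually.of_forall fun ξ hξ => hb ξ ⟨hξ.1.le, hξ.2⟩)
      (hcd.intervalIntegrable.const_mul _)
    refine this.trans ?_
    rw [intervalIntegral.integral_const_mul, hi, div_mul_eq_mul_div]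
    have h1 := Real.arcsin_le_pi_div_two d
    have h2 := Real.neg_pi_div_two_le_arcsin a
    have h3 := Real.pi_lt_four
    gcongr
    linarith
  · refine norm_integral_arc_le_of_curved hk (by linarith [hd.1]) hd.2 hc x Y
      (Or.inr (by nlinarith [hd.1])) (Or.inr fun ξ hξ => ?_)
    have h1 := h ξ hξ
    have h2 : arc ξ ^ 3 ≤ arc ξ := pow_le_of_le_one (arc_nonneg ξ) (arc_le_one ξ) (by norm_num)
    have h3 := arc_nonneg ξ
    linarith

lemma abs_sub_linear_le {a b M x₀ x : ℝ} {f f₁ f₂ : ℝ → ℝ}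
    (hf : ∀ y ∈ Set.Icc a b, HasDerivAt f (f₁ y) y)
    (hf₁ : ∀ y ∈ Set.Icc a b, HasDerivAt f₁ (f₂ y) y) (hM : ∀ y ∈ Set.Icc a b, |f₂ y| ≤ M)
    (hx₀ : x₀ ∈ Set.Icc a b) (hx : x ∈ Set.Icc a b) :
    |f x - f x₀ - f₁ x₀ * (x - x₀)| ≤ M * (x - x₀) ^ 2 := by
  have hM0 : 0 ≤ M := (abs_nonneg _).trans (hM x hx)
  have hsub : Set.uIcc x₀ x ⊆ Set.Icc a b := Set.uIcc_subset_Icc hx₀ hx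
  have b1 : ∀ z ∈ Set.uIcc x₀ x, ‖f₁ z - f₁ x₀‖ ≤ M * |x - x₀| := fun z hz => by
    have := (convex_uIcc x₀ x).norm_image_sub_le_of_norm_hasDerivWithin_le
      (fun y hy => (hf₁ y (hsub hy)).hasDerivWithinAt) (fun y hy => hM y (hsub hy))
      Set.left_mem_uIcc hz
    refine this.trans (mul_le_mul_of_nonneg_left ?_ hM0)
    exact Set.abs_sub_left_of_mem_uIcc hz
  have := (convex_uIcc x₀ x).norm_image_sub_le_of_norm_hasDerivWithin_le
    (f := fun z => f z - f₁ x₀ * z) (f' := fun z => f₁ z - f₁ x₀)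
    (fun y hy => by
      have := (hf y (hsub hy)).fun_sub ((hasDerivAt_id y).const_mul (f₁ x₀))
      simpa using this.hasDerivWithinAt)
    b1 Set.left_mem_uIcc Set.right_mem_uIcc
  rw [Real.norm_eq_abs, Real.norm_eq_abs, mul_assoc, ← sq, sq_abs] at this
  refine le_trans (le_of_eq ?_) this
  congr 1
  ring

lemma abs_boundaryAmp_sub_le {k D D₁ s ξ ξ₀ : ℝ} (hk : 0 < k) (hξ : 1 / 2 ≤ ξ) (hξ₀ : 1 / 2 ≤ ξ₀)
    (hs : |ξ - ξ₀| ≤ |s|) (h : |D - D₁ * s| ≤ 50 * s ^ 2) (hD : |s| / 4 ≤ |D|)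
    (hD₁ : 1 / 4 ≤ |D₁|) :
    |k * D / ((k * D) ^ 2 + ξ) - k * (D₁ * s) / ((k * (D₁ * s)) ^ 2 + ξ₀)| ≤ 2000 / k := by
  set e := |s| * k with he
  have he0 : 0 ≤ e := by positivity
  set ρ := k * D with hρ
  set ρ₁ := k * (D₁ * s) with hρ₁
  have h1 : e ≤ 4 * |ρ| := by
    rw [hρ, abs_mul, abs_of_pos hk, he]
    nlinarith
  have h2 : e ≤ 4 * |ρ₁| := by
    rw [hρ₁, abs_mul, abs_of_pos hk, abs_mul, he]
    nlinarith [mul_le_mul_of_nonneg_right hD₁ (mul_nonneg hk.le (abs_nonneg s))]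
  have h3 : |ρ - ρ₁| ≤ 50 * e ^ 2 / k := by
    rw [hρ, hρ₁, ← mul_sub, abs_mul, abs_of_pos hk, he, le_div_iff₀ hk, mul_pow, sq_abs]
    nlinarith [mul_le_mul_of_nonneg_right h (sq_nonneg k)]
  have h4 : |ξ - ξ₀| ≤ e / k := by
    rw [he, mul_div_assoc, div_self hk.ne', mul_one]
    exact hs
  have hP1 : 0 < ρ ^ 2 + ξ := by positivity
  have hP2 : 0 < ρ₁ ^ 2 + ξ₀ := by positivity
  rw [div_sub_div _ _ hP1.ne' hP2.ne', abs_div, abs_of_pos (mul_pos hP1 hP2),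
    div_le_iff₀ (mul_pos hP1 hP2)]
  have eN : ρ * (ρ₁ ^ 2 + ξ₀) - (ρ ^ 2 + ξ) * ρ₁ =
      (ξ₀ - ρ * ρ₁) * (ρ - ρ₁) - ρ₁ * (ξ - ξ₀) := by ring
  have q1 : e ^ 2 ≤ 16 * ρ ^ 2 := by
    rw [← sq_abs ρ]
    nlinarith [abs_nonneg ρ]
  have q2 : e ^ 2 ≤ 16 * (|ρ| * |ρ₁|) := by nlinarith [abs_nonneg ρ, abs_nonneg ρ₁]
  have q3 : |ρ₁| * e ≤ 4 * ρ₁ ^ 2 := by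
    rw [← sq_abs ρ₁]
    nlinarith [abs_nonneg ρ₁]
  have t1 : |ξ₀ - ρ * ρ₁| ≤ ξ₀ + |ρ| * |ρ₁| := by
    refine (abs_sub _ _).trans ?_
    rw [abs_mul, abs_of_nonneg (by linarith : 0 ≤ ξ₀)]
  have t2 : (ξ₀ + |ρ| * |ρ₁|) * e ^ 2 ≤ 32 * ((ρ ^ 2 + ξ) * (ρ₁ ^ 2 + ξ₀)) := by
    have u1 : ξ₀ * e ^ 2 ≤ ξ₀ * (16 * ρ ^ 2) := by gcongr
    have u2 : |ρ| * |ρ₁| * e ^ 2 ≤ 16 * (ρ ^ 2 * ρ₁ ^ 2) := by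
      rw [← sq_abs ρ, ← sq_abs ρ₁]
      nlinarith [mul_nonneg (abs_nonneg ρ) (abs_nonneg ρ₁)]
    have u3 : 0 ≤ ρ ^ 2 * ρ₁ ^ 2 := by positivity
    have u4 : 0 ≤ ξ * (ρ₁ ^ 2 + ξ₀) := by positivity
    have u5 : 0 ≤ ρ ^ 2 * ξ₀ := by positivity
    nlinarith
  have t3 : |ρ₁| * e ≤ 8 * ((ρ ^ 2 + ξ) * (ρ₁ ^ 2 + ξ₀)) := by
    have u1 : 0 ≤ ρ ^ 2 * (ρ₁ ^ 2 + ξ₀) := by positivity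
    have u2 : 0 ≤ ξ * ξ₀ := by positivity
    nlinarith [sq_nonneg ρ₁]
  have hPP := mul_pos hP1 hP2
  rw [eN]
  calc |(ξ₀ - ρ * ρ₁) * (ρ - ρ₁) - ρ₁ * (ξ - ξ₀)|
      ≤ |ξ₀ - ρ * ρ₁| * |ρ - ρ₁| + |ρ₁| * |ξ - ξ₀| := by
        refine (abs_sub _ _).trans ?_
        rw [abs_mul, abs_mul]
    _ ≤ (ξ₀ + |ρ| * |ρ₁|) * (50 * e ^ 2 / k) + |ρ₁| * (e / k) := by gcongr
    _ = (50 * ((ξ₀ + |ρ| * |ρ₁|) * e ^ 2) + |ρ₁| * e) / k := by ring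
    _ ≤ 2000 * ((ρ ^ 2 + ξ) * (ρ₁ ^ 2 + ξ₀)) / k := by
        gcongr
        linarith
    _ = 2000 / k * ((ρ ^ 2 + ξ) * (ρ₁ ^ 2 + ξ₀)) := by ring

lemma arc_bounds {ξ : ℝ} (hξ : ξ ∈ Set.Icc (77 / 100 : ℝ) (94 / 100)) :
    341 / 1000 ≤ arc ξ ∧ arc ξ ≤ 64 / 100 :=
  ⟨Real.le_sqrt_of_sq_le (by nlinarith [hξ.1, hξ.2]),
    Real.sqrt_le_iff.2 ⟨by norm_num, by nlinarith [hξ.1, hξ.2]⟩⟩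

lemma one_div_arc_le {ξ : ℝ} (hξ : ξ ∈ Set.Icc (77 / 100 : ℝ) (94 / 100)) : 1 / arc ξ ≤ 3 := by
  have := (arc_bounds hξ).1
  rw [div_le_iff₀ (by linarith)]
  linarith

lemma mulArc'_le {ξ : ℝ} (hξ : ξ ∈ Set.Icc (77 / 100 : ℝ) (94 / 100)) : mulArc' ξ ≤ -(1 / 4) := by
  have h1 := arc_bounds hξ
  rw [mulArc'_eq (by linarith [hξ.1]) (by linarith [hξ.2]), div_le_iff₀ (by linarith)]
  nlinarith [hξ.1]

lemma hasDerivAt_mulArc' {ξ : ℝ} (h0 : 0 ≤ ξ) (h1 : ξ < 1) :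
    HasDerivAt mulArc' (-(ξ * (2 * (1 / arc ξ) + (1 / arc ξ) ^ 3))) ξ := by
  refine ((hasDerivAt_arc h0 h1).fun_add
    ((hasDerivAt_id ξ).fun_mul (hasDerivAt_arc' h0 h1))).congr_deriv ?_
  have := arc_pos h0 h1
  simp only [id]
  field_simp
  ring

lemma abs_mulArc_sub_ge {ξ ξ₀ : ℝ} (hξ : ξ ∈ Set.Icc (77 / 100 : ℝ) (94 / 100))
    (hξ₀ : ξ₀ ∈ Set.Icc (77 / 100 : ℝ) (94 / 100)) :
    |ξ - ξ₀| / 4 ≤ |ξ * arc ξ - ξ₀ * arc ξ₀| := by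
  have hd : ∀ y ∈ Set.Icc (77 / 100 : ℝ) (94 / 100),
      HasDerivAt (fun y => y * arc y + 1 / 4 * y) (mulArc' y + 1 / 4) y := fun y hy => by
    have := (hasDerivAt_mulArc (by linarith [hy.1]) (by linarith [hy.2] : y < 1)).fun_add
      ((hasDerivAt_id y).const_mul (1 / 4))
    simpa using this
  have h : AntitoneOn (fun y => y * arc y + 1 / 4 * y) (Set.Icc (77 / 100 : ℝ) (94 / 100)) :=
    antitoneOn_of_deriv_nonpos (convex_Icc _ _)
      (fun y hy => (hd y hy).continuousAt.continuousWithinAt)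
      (fun y hy => (hd y (interior_subset hy)).differentiableAt.differentiableWithinAt)
      fun y hy => by
        rw [(hd y (interior_subset hy)).deriv]
        linarith [mulArc'_le (interior_subset hy)]
  rcases le_total ξ ξ₀ with hle | hle
  · have := h hξ hξ₀ hle
    simp only at this
    rw [abs_of_nonpos (by linarith)]
    exact le_trans (by linarith) (le_abs_self _)
  · have := h hξ₀ hξ hle
    simp only at this
    rw [abs_of_nonneg (by linarith)]
    exact le_trans (by linarith) (neg_le_abs _)

lemma arcPhase'''_bounds (k : ℝ) {ξ ξ₀ : ℝ} (hξ : ξ ∈ Set.Icc (77 / 100 : ℝ) (94 / 100))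
    (hξ₀ : ξ₀ ∈ Set.Icc (77 / 100 : ℝ) (94 / 100)) :
    k ^ 2 ≤ -arcPhase''' k (ξ₀ * arc ξ₀) ξ ∧ -arcPhase''' k (ξ₀ * arc ξ₀) ξ ≤ 5000 * k ^ 2 := by
  obtain ⟨a1, a2⟩ := arc_bounds hξ
  obtain ⟨c1, c2⟩ := arc_bounds hξ₀
  have h0 : 0 < arc ξ := by linarith
  have e : -arcPhase''' k (ξ₀ * arc ξ₀) ξ =
      k ^ 2 * (18 * (ξ₀ * arc ξ₀ * ξ / arc ξ ^ 5) - 24) := by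
    rw [arcPhase''']
    field_simp
    ring
  have p1 : 25 / 100 ≤ ξ₀ * arc ξ₀ := by nlinarith [hξ₀.1]
  have p2 : ξ₀ * arc ξ₀ ≤ 1 := by nlinarith [hξ₀.1, hξ₀.2]
  have q1 : 19 / 100 ≤ ξ₀ * arc ξ₀ * ξ := by nlinarith [hξ.1]
  have q2 : ξ₀ * arc ξ₀ * ξ ≤ 1 := by nlinarith [hξ.1, hξ.2]
  have r1 : arc ξ ^ 5 ≤ (64 / 100) ^ 5 := pow_le_pow_left₀ h0.le a2 5
  have r2 : (341 / 1000) ^ 5 ≤ arc ξ ^ 5 := pow_le_pow_left₀ (by norm_num) a1 5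
  have s1 : 25 / 18 ≤ ξ₀ * arc ξ₀ * ξ / arc ξ ^ 5 := by
    rw [le_div_iff₀ (by positivity)]
    norm_num at r1
    linarith
  have s2 : ξ₀ * arc ξ₀ * ξ / arc ξ ^ 5 ≤ 250 := by
    rw [div_le_iff₀ (by positivity)]
    norm_num at r2
    linarith
  rw [e]
  constructor <;> nlinarith [sq_nonneg k]

lemma norm_integral_arcPhase_oddKernel_le {k ε ξ₀ : ℝ} (hk : 0 < k) (hε : 0 < ε)
    (hξ₀ : ξ₀ ∈ Set.Icc (78 / 100 : ℝ) (93 / 100)) (x : ℝ) :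
    ‖∫ s in (-(1 / 100 : ℝ))..(1 / 100), cis (arcPhase k x (ξ₀ * arc ξ₀) (ξ₀ + s)) *
      oddKernel ε s‖ ≤ 10048 := by
  have hI : ∀ s ∈ Set.Icc (-(1 / 100 : ℝ)) (1 / 100),
      ξ₀ + s ∈ Set.Icc (77 / 100 : ℝ) (94 / 100) := fun s hs =>
    ⟨by linarith [hs.1, hξ₀.1], by linarith [hs.2, hξ₀.2]⟩
  have hξ₀' : ξ₀ ∈ Set.Icc (77 / 100 : ℝ) (94 / 100) :=
    ⟨by linarith [hξ₀.1], by linarith [hξ₀.2]⟩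
  have h0 : ∀ s ∈ Set.Icc (-(1 / 100 : ℝ)) (1 / 100), 0 ≤ ξ₀ + s := fun s hs => by
    linarith [(hI s hs).1]
  have h1 : ∀ s ∈ Set.Icc (-(1 / 100 : ℝ)) (1 / 100), ξ₀ + s < 1 := fun s hs => by
    linarith [(hI s hs).2]
  rw [← norm_integral_cis_neg_mul_ofReal]
  refine (norm_integral_cubic_oddKernel_le hε (m := k ^ 2) (M := 5000) (by positivity)
    (by norm_num) (by norm_num)
    (fun s hs => ((hasDerivAt_arcPhase k x _ (h0 s hs) (h1 s hs)).comp_const_add ξ₀ s).fun_neg)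
    (fun s hs => ((hasDerivAt_arcPhase' k x _ (h0 s hs) (h1 s hs)).comp_const_add ξ₀ s).fun_neg)
    (fun s hs => ((hasDerivAt_arcPhase'' k _ (h0 s hs) (h1 s hs)).comp_const_add ξ₀ s).fun_neg)
    (fun s hs => (arcPhase'''_bounds k (hI s hs) hξ₀').1)
    (fun s hs => (arcPhase'''_bounds k (hI s hs) hξ₀').2)).trans_eq (by norm_num)

lemma norm_integral_arc_null_le {k ξ₀ : ℝ} (hk : 0 < k)
    (hξ₀ : ξ₀ ∈ Set.Icc (78 / 100 : ℝ) (93 / 100)) (x : ℝ) :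
    ‖∫ ξ in (ξ₀ - 1 / 100)..(ξ₀ + 1 / 100), arcIntegrand k x (ξ₀ * arc ξ₀) ξ‖ ≤ 41000 / k := by
  have hcont := continuous_arc
  have hξ₀' : ξ₀ ∈ Set.Icc (77 / 100 : ℝ) (94 / 100) :=
    ⟨by linarith [hξ₀.1], by linarith [hξ₀.2]⟩
  have hξp : 0 < ξ₀ := by linarith [hξ₀.1]
  set D₁ := mulArc' ξ₀ with hD₁
  have hD : D₁ ≤ -(1 / 4) := mulArc'_le hξ₀'
  have hDa : 1 / 4 ≤ |D₁| := by rw [abs_of_nonpos (by linarith)]; linarith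
  have hD0 : D₁ ≠ 0 := by linarith
  have hkD : k * D₁ ≠ 0 := mul_ne_zero hk.ne' hD0
  set ε := √(ξ₀ / (k * D₁) ^ 2) with hε
  have hε2 : ε ^ 2 = ξ₀ / (k * D₁) ^ 2 := Real.sq_sqrt (by positivity)
  have hε0 : 0 < ε := Real.sqrt_pos.2 (by positivity)
  have hsub : Set.Icc (ξ₀ - 1 / 100) (ξ₀ + 1 / 100) ⊆ Set.Icc (77 / 100 : ℝ) (94 / 100) :=
    Set.Icc_subset_Icc (by linarith [hξ₀.1]) (by linarith [hξ₀.2])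
  set G : ℝ → ℂ := fun ξ => cis (arcPhase k x (ξ₀ * arc ξ₀) ξ) *
    (k * (D₁ * (ξ - ξ₀)) / ((k * (D₁ * (ξ - ξ₀))) ^ 2 + ξ₀) : ℝ) with hG
  have hGc : Continuous G := by
    refine Continuous.mul (continuous_cis.comp ?_) (Complex.continuous_ofReal.comp
      (Continuous.div (by fun_prop) (by fun_prop) fun ξ => by positivity))
    unfold arcPhase
    fun_prop
  have hdiff : ∀ ξ ∈ Set.Icc (ξ₀ - 1 / 100) (ξ₀ + 1 / 100),
      ‖arcIntegrand k x (ξ₀ * arc ξ₀) ξ - G ξ‖ ≤ 2000 / k := fun ξ hξ => by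
    rw [arcIntegrand, hG, ← mul_sub, norm_mul, norm_cis, one_mul, ← Complex.ofReal_sub,
      Complex.norm_real, Real.norm_eq_abs]
    have hξ' := hsub hξ
    refine abs_boundaryAmp_sub_le hk (by linarith [hξ'.1]) (by linarith [hξ₀.1]) le_rfl ?_
      (abs_mulArc_sub_ge hξ' hξ₀') hDa
    refine abs_sub_linear_le (f := fun y => y * arc y) (f₁ := mulArc')
      (fun y hy => hasDerivAt_mulArc (by linarith [hy.1]) (by linarith [hy.2]))
      (fun y hy => hasDerivAt_mulArc' (by linarith [hy.1]) (by linarith [hy.2]))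
      (fun y hy => ?_) hξ₀' hξ'
    have i0 : 0 ≤ 1 / arc y := by have := arc_nonneg y; positivity
    have i1 := one_div_arc_le hy
    have i3 : (1 / arc y) ^ 3 ≤ 3 ^ 3 := pow_le_pow_left₀ i0 i1 3
    have y0 : 0 ≤ y := by linarith [hy.1]
    rw [abs_neg, abs_of_nonneg (by positivity)]
    nlinarith [hy.2]
  have hGi : ∫ ξ in (ξ₀ - 1 / 100)..(ξ₀ + 1 / 100), G ξ = (1 / (k * D₁) : ℝ) *
      ∫ s in (-(1 / 100 : ℝ))..(1 / 100), cis (arcPhase k x (ξ₀ * arc ξ₀) (ξ₀ + s)) *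
      oddKernel ε s := by
    have := intervalIntegral.integral_comp_add_left (a := -(1 / 100 : ℝ)) (b := 1 / 100) G ξ₀
    rw [← sub_eq_add_neg] at this
    rw [← this, ← intervalIntegral.integral_const_mul]
    refine intervalIntegral.integral_congr fun s _ => ?_
    have e : k * (D₁ * (ξ₀ + s - ξ₀)) / ((k * (D₁ * (ξ₀ + s - ξ₀))) ^ 2 + ξ₀) =
        1 / (k * D₁) * oddKernel ε s := by
      have e1 : (k * (D₁ * (ξ₀ + s - ξ₀))) ^ 2 + ξ₀ = (k * D₁) ^ 2 * (s ^ 2 + ε ^ 2) := by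
        rw [hε2]
        field_simp
        ring
      have e2 : s ^ 2 + ε ^ 2 ≠ 0 := by positivity
      rw [e1, oddKernel, add_sub_cancel_left]
      field_simp
    simp only [hG, e]
    push_cast
    ring
  have hle : ξ₀ - 1 / 100 ≤ ξ₀ + 1 / 100 := by linarith
  have hFi : IntervalIntegrable (arcIntegrand k x (ξ₀ * arc ξ₀)) volume (ξ₀ - 1 / 100)
      (ξ₀ + 1 / 100) := by
    refine ContinuousOn.intervalIntegrable ?_
    rw [Set.uIcc_of_le hle]
    exact continuousOn_arcIntegrand (by linarith [hξ₀.1]) k x _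
  have h1 := intervalIntegral.norm_integral_le_of_norm_le_const (a := ξ₀ - 1 / 100)
    (b := ξ₀ + 1 / 100) (C := 2000 / k) (f := fun ξ => arcIntegrand k x (ξ₀ * arc ξ₀) ξ - G ξ)
    (fun ξ hξ => by
      rw [Set.uIoc_of_le hle] at hξ
      exact hdiff ξ ⟨hξ.1.le, hξ.2⟩)
  have e2 : |ξ₀ + 1 / 100 - (ξ₀ - 1 / 100)| = 1 / 50 := by
    rw [abs_of_nonneg (by linarith)]
    ring
  rw [intervalIntegral.integral_sub hFi (hGc.intervalIntegrable _ _), hGi, e2] at h1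
  have h2 := norm_integral_arcPhase_oddKernel_le hk hε0 hξ₀ x
  set J := ∫ s in (-(1 / 100 : ℝ))..(1 / 100), cis (arcPhase k x (ξ₀ * arc ξ₀) (ξ₀ + s)) *
      oddKernel ε s
  have h3 : ‖((1 / (k * D₁) : ℝ) : ℂ) * J‖ ≤ 4 / k * 10048 := by
    rw [norm_mul, Complex.norm_real, Real.norm_eq_abs, abs_div, abs_one, abs_mul, abs_of_pos hk]
    refine mul_le_mul ?_ h2 (norm_nonneg _) (by positivity)
    rw [div_le_div_iff₀ (by positivity) hk]
    nlinarith
  refine (norm_le_norm_add_norm_sub' _ (((1 / (k * D₁) : ℝ) : ℂ) * J)).trans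
    ((add_le_add h3 h1).trans ?_)
  rw [div_mul_eq_mul_div, div_mul_eq_mul_div, ← add_div]
  gcongr
  norm_num

lemma antitoneOn_mulArc {a c : ℝ} (ha : 7 / 10 ≤ a) (ha' : 1 ≤ 2 * a ^ 2) (hc : c < 1) :
    AntitoneOn (fun ξ => ξ * arc ξ) (Set.Icc a c) := by
  have hd : ∀ ξ ∈ Set.Icc a c, HasDerivAt (fun ξ => ξ * arc ξ) (mulArc' ξ) ξ := fun ξ hξ =>
    hasDerivAt_mulArc (by linarith [hξ.1]) (hξ.2.trans_lt hc)
  refine antitoneOn_of_deriv_nonpos (convex_Icc a c)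
    (fun ξ hξ => (hd ξ hξ).continuousAt.continuousWithinAt)
    (fun ξ hξ => (hd ξ (interior_subset hξ)).differentiableAt.differentiableWithinAt)
    fun ξ hξ => ?_
  have hξ' := interior_subset hξ
  rw [(hd ξ hξ').deriv, mulArc'_eq (by linarith [hξ'.1]) (hξ'.2.trans_lt hc)]
  refine div_nonpos_of_nonpos_of_nonneg ?_ (arc_nonneg ξ)
  nlinarith [hξ'.1]

lemma norm_integral_arc_upper_le {k a b : ℝ} (hk : 0 < k) (ha : 7 / 10 ≤ a) (ha1 : a ≤ 75 / 100)
    (ha2 : 1 ≤ 2 * a ^ 2) (hb : 99 / 100 ≤ b) (hb1 : b < 1) (x Y : ℝ) :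
    ‖∫ ξ in a..b, arcIntegrand k x Y ξ‖ ≤ 43000 / k := by
  have hii : ∀ u v, 1 / 2 ≤ u → u ≤ v → IntervalIntegrable (arcIntegrand k x Y) volume u v :=
    fun u v hu huv => ContinuousOn.intervalIntegrable (by
      rw [Set.uIcc_of_le huv]
      exact continuousOn_arcIntegrand hu k x Y)
  have split : ∀ u v w, 1 / 2 ≤ u → u ≤ v → v ≤ w → ∀ A B : ℝ,
      ‖∫ ξ in u..v, arcIntegrand k x Y ξ‖ ≤ A / k → ‖∫ ξ in v..w, arcIntegrand k x Y ξ‖ ≤ B / k →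
      ‖∫ ξ in u..w, arcIntegrand k x Y ξ‖ ≤ (A + B) / k := by
    intro u v w hu huv hvw A B h1 h2
    rw [← intervalIntegral.integral_add_adjacent_intervals (hii u v hu huv)
      (hii v w (hu.trans huv) hvw), add_div]
    exact (norm_add_le _ _).trans (add_le_add h1 h2)
  have left : ∀ c, a ≤ c → c ≤ 4 / 5 → ‖∫ ξ in a..c, arcIntegrand k x Y ξ‖ ≤ 175 / k :=
    fun c h1 h2 => norm_integral_arc_left_le hk (by linarith) h1 h2 x Y (Or.inr ha2)
  have right : ∀ c, 23 / 25 ≤ c → c ≤ b → ‖∫ ξ in c..b, arcIntegrand k x Y ξ‖ ≤ 181 / k :=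
    fun c h1 h2 => norm_integral_arc_right_le hk h1 h2 hb1 x Y
  have mid : (∀ ξ ∈ Set.Icc (4 / 5 : ℝ) (23 / 25), 1 / 200 ≤ |ξ * arc ξ - Y|) →
      ‖∫ ξ in a..b, arcIntegrand k x Y ξ‖ ≤ 43000 / k := by
    intro h
    have h1 := norm_integral_arc_le_of_large hk (by norm_num) (by norm_num) (by norm_num)
      (by norm_num) x Y h
    have h2 := split a (4 / 5) (23 / 25) (by linarith) (by linarith) (by norm_num) _ _
      (left (4 / 5) (by linarith) le_rfl) h1
    refine (split a (23 / 25) b (by linarith) (by linarith) (by linarith) _ _ h2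
      (right _ le_rfl (by linarith))).trans ?_
    gcongr
    norm_num
  have anti := antitoneOn_mulArc (a := 75 / 100) (c := 95 / 100) (by norm_num) (by norm_num)
    (by norm_num)
  rcases lt_or_ge Y (342 / 1000) with hY | hY
  · refine mid fun ξ hξ => ?_
    have h1 := anti (a := ξ) (b := 23 / 25) ⟨by linarith [hξ.1], by linarith [hξ.2]⟩
      ⟨by norm_num, by norm_num⟩ hξ.2
    have h2 : 39 / 100 ≤ arc (23 / 25) := Real.le_sqrt_of_sq_le (by norm_num)
    simp only at h1
    exact le_trans (by linarith) (le_abs_self _)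
  rcases lt_or_ge (488 / 1000) Y with hY' | hY'
  · refine mid fun ξ hξ => ?_
    have h1 := anti (a := 4 / 5) (b := ξ) ⟨by norm_num, by norm_num⟩
      ⟨by linarith [hξ.1], by linarith [hξ.2]⟩ hξ.1
    have h2 : arc (4 / 5) ≤ 3 / 5 := Real.sqrt_le_iff.2 ⟨by norm_num, by norm_num⟩
    simp only at h1
    exact le_trans (by linarith) (neg_le_abs _)
  have hc : ContinuousOn (fun ξ => ξ * arc ξ) (Set.Icc (78 / 100 : ℝ) (93 / 100)) :=
    (continuous_id.mul continuous_arc).continuousOn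
  obtain ⟨ξ₀, hξ₀, hYξ⟩ := intermediate_value_Icc' (by norm_num) hc (show Y ∈ Set.Icc _ _ from by
    have h1 : arc (93 / 100) ≤ 3676 / 10000 := Real.sqrt_le_iff.2 ⟨by norm_num, by norm_num⟩
    have h2 : 6257 / 10000 ≤ arc (78 / 100) := Real.le_sqrt_of_sq_le (by norm_num)
    constructor <;> linarith)
  simp only at hYξ
  have null := norm_integral_arc_null_le hk hξ₀ x
  have far : ∀ u v, 77 / 100 ≤ u → u ≤ v → v ≤ 94 / 100 →
      (∀ ξ ∈ Set.Icc u v, 1 / 100 ≤ |ξ - ξ₀|) →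
      ‖∫ ξ in u..v, arcIntegrand k x Y ξ‖ ≤ 400 / k := by
    intro u v hu huv hv h
    refine (norm_integral_arc_le_of_large (d := 1 / 400) hk (by linarith) huv (by linarith)
      (by norm_num) x Y fun ξ hξ => ?_).trans_eq (by norm_num)
    have h1 := abs_mulArc_sub_ge (ξ := ξ) (ξ₀ := ξ₀) ⟨by linarith [hξ.1], by linarith [hξ.2]⟩
      ⟨by linarith [hξ₀.1], by linarith [hξ₀.2]⟩
    rw [← hYξ]
    linarith [h ξ hξ]
  rw [hYξ] at null
  set p := min (4 / 5) (ξ₀ - 1 / 100) with hp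
  set r := max (23 / 25) (ξ₀ + 1 / 100) with hr
  have p1 : p ≤ 4 / 5 := min_le_left _ _
  have p2 : p ≤ ξ₀ - 1 / 100 := min_le_right _ _
  have p3 : 77 / 100 ≤ p := le_min (by norm_num) (by linarith [hξ₀.1])
  have r1 : 23 / 25 ≤ r := le_max_left _ _
  have r2 : ξ₀ + 1 / 100 ≤ r := le_max_right _ _
  have r3 : r ≤ 94 / 100 := max_le (by norm_num) (by linarith [hξ₀.2])
  have hl := hξ₀.1
  have hu := hξ₀.2
  have s1 := split a p (ξ₀ - 1 / 100) (by linarith) (by linarith) p2 _ _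
    (left p (by linarith) p1) (far p (ξ₀ - 1 / 100) p3 p2 (by linarith) fun ξ hξ => by
      refine le_trans ?_ (neg_le_abs _)
      linarith [hξ.2])
  have s2 := split a (ξ₀ - 1 / 100) (ξ₀ + 1 / 100) (by linarith) (by linarith) (by linarith) _ _
    s1 null
  have s3 := split a (ξ₀ + 1 / 100) r (by linarith) (by linarith) r2 _ _ s2
    (far (ξ₀ + 1 / 100) r (by linarith) r2 r3 fun ξ hξ => by
      refine le_trans ?_ (le_abs_self _)
      linarith [hξ.1])
  refine (split a r b (by linarith) (by linarith) (by linarith) _ _ s3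
    (right r r1 (by linarith))).trans ?_
  gcongr
  norm_num

lemma continuousOn_fiber (k x Y : ℝ) {β : ℝ → ℝ} (hβ : Continuous β) :
    Continuous fun ξ => ∫ η in (0 : ℝ)..β ξ,
      cis (k ^ 2 * (ξ ^ 3 - 3 * ξ * η ^ 2) + x * ξ + 6 * k ^ 2 * Y * η) := by
  refine intervalIntegral.continuous_parametric_intervalIntegral_of_continuous
    (f := fun ξ η => cis (k ^ 2 * (ξ ^ 3 - 3 * ξ * η ^ 2) + x * ξ + 6 * k ^ 2 * Y * η))
    (continuous_cis.comp ?_) hβ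
  fun_prop

lemma norm_stripIntegral_arc_le {k : ℝ} (hk : 0 < k) (x Y : ℝ) :
    ‖stripIntegral k x Y arc (1 / 2) 1‖ ≤ 44000 / k ^ 2 := by
  have hc := continuousOn_fiber k x Y continuous_arc
  set a := √(1 / 2) with ha
  have ha2 : a ^ 2 = 1 / 2 := Real.sq_sqrt (by norm_num)
  have ha7 : 7 / 10 ≤ a := Real.le_sqrt_of_sq_le (by norm_num)
  have ha8 : a ≤ 75 / 100 := Real.sqrt_le_iff.2 ⟨by norm_num, by norm_num⟩
  have hder : ∀ b < 1, ∀ u, 1 / 2 ≤ u → ∀ ξ ∈ Set.Icc u b,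
      HasDerivAt arc (-ξ / arc ξ) ξ := fun b hb u hu ξ hξ =>
    hasDerivAt_arc (by linarith [hξ.1]) (hξ.2.trans_lt hb)
  have hderc : ∀ b < 1, ∀ u, 1 / 2 ≤ u → ContinuousOn (fun ξ => -ξ / arc ξ) (Set.Icc u b) :=
    fun b hb u hu ξ hξ => (hasDerivAt_arc' (by linarith [hξ.1])
      (hξ.2.trans_lt hb)).continuousAt.continuousWithinAt
  have sgn : ∀ ξ, 0 ≤ ξ → ξ < 1 → arc ξ + ξ * (-ξ / arc ξ) = (1 - 2 * ξ ^ 2) / arc ξ :=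
    fun ξ h0 h1 => mulArc'_eq h0 h1
  have h1 : ‖stripIntegral k x Y arc (1 / 2) a‖ ≤ 586 / k / k := by
    refine (norm_stripIntegral_le hk le_rfl (by linarith) (by linarith) x Y
      (hder a (by linarith) _ le_rfl) (hderc a (by linarith) _ le_rfl)
      (Or.inl fun ξ hξ => ?_)).trans ?_
    · have : 0 ≤ ξ := by linarith [hξ.1]
      rw [sgn ξ this (by linarith [hξ.2])]
      refine div_nonneg ?_ (arc_nonneg ξ)
      nlinarith [hξ.2]
    · rw [boundaryIntegral_arc (by norm_num) (by linarith) (by linarith)]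
      have := norm_integral_arc_left_le hk le_rfl (by linarith : 1 / 2 ≤ a) (by linarith) x Y
        (Or.inl (by linarith))
      gcongr
      refine (add_le_add this le_rfl).trans_eq ?_
      ring
  have h2 : ∀ b, 99 / 100 ≤ b → b < 1 → ‖stripIntegral k x Y arc a b‖ ≤ 43411 / k / k := by
    intro b hb hb1
    refine (norm_stripIntegral_le hk (by linarith) (by linarith) hb1.le x Y
      (hder b hb1 _ (by linarith)) (hderc b hb1 _ (by linarith))
      (Or.inr fun ξ hξ => ?_)).trans ?_
    · have : 0 ≤ ξ := by linarith [hξ.1]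
      rw [sgn ξ this (by linarith [hξ.2])]
      refine div_nonpos_of_nonpos_of_nonneg ?_ (arc_nonneg ξ)
      nlinarith [hξ.1]
    · rw [boundaryIntegral_arc (by linarith) (by linarith) hb1.le]
      have := norm_integral_arc_upper_le hk ha7 ha8 (by linarith) hb hb1 x Y
      gcongr
      refine (add_le_add this le_rfl).trans_eq ?_
      ring
  have hlim : Filter.Tendsto (fun b => stripIntegral k x Y arc a b) (nhdsWithin 1 (Set.Iio 1))
      (nhds (stripIntegral k x Y arc a 1)) :=
    ((intervalIntegral.continuous_primitive (fun u v => hc.intervalIntegrable u v)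
      a).continuousAt).mono_left nhdsWithin_le_nhds
  have h3 : ‖stripIntegral k x Y arc a 1‖ ≤ 43411 / k / k := by
    refine le_of_tendsto hlim.norm ?_
    filter_upwards [Ioo_mem_nhdsLT (show (99 / 100 : ℝ) < 1 by norm_num)] with b hb
    exact h2 b hb.1.le hb.2
  have hadd : stripIntegral k x Y arc (1 / 2) 1 =
      stripIntegral k x Y arc (1 / 2) a + stripIntegral k x Y arc a 1 :=
    (intervalIntegral.integral_add_adjacent_intervals (hc.intervalIntegrable _ _)
      (hc.intervalIntegrable _ _)).symm
  rw [hadd]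
  refine (norm_add_le _ _).trans ((add_le_add h1 h3).trans ?_)
  rw [sq, ← div_div, ← add_div, ← add_div]
  gcongr
  norm_num

/-- The oscillating factor with cubic part `lam * φ` and frequency `(p, q)`. -/
noncomputable def osc (lam p q : ℝ) (w : ℝ × ℝ) : ℂ :=
  cis (lam * phiNV w.1 w.2 + (p * w.1 + q * w.2))

theorem continuous_osc (lam p q : ℝ) : Continuous (osc lam p q) := by
  unfold osc phiNV
  exact continuous_cis.comp (by fun_prop)

theorem norm_osc (lam p q : ℝ) (w : ℝ × ℝ) : ‖osc lam p q w‖ = 1 := norm_cis _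

/-- The dilate by `R` of the region under the graph of `β` over `(1/2, 1]`. -/
def dilatedRegion (β : ℝ → ℝ) (R : ℝ) : Set (ℝ × ℝ) :=
  regionBetween (fun _ => 0) (fun ξ => R * β (ξ / R)) (Set.Ioc (R / 2) R)

theorem measurableSet_dilatedRegion {β : ℝ → ℝ} (hβ : Continuous β) (R : ℝ) :
    MeasurableSet (dilatedRegion β R) :=
  measurableSet_regionBetween measurable_const
    (by have := hβ.measurable; fun_prop) measurableSet_Ioc

theorem integrableOn_osc_of_bounded (lam p q : ℝ) {s : Set (ℝ × ℝ)}
    (hs : Bornology.IsBounded s) : IntegrableOn (osc lam p q) s :=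
  ((continuous_osc lam p q).continuousOn.integrableOn_compact
    (hs.isCompact_closure)).mono_set subset_closure

theorem isBounded_dilatedRegion {β : ℝ → ℝ} (hβ : Continuous β) {R : ℝ} :
    Bornology.IsBounded (dilatedRegion β R) := by
  obtain ⟨M, hM⟩ := (isCompact_Icc (a := R / 2) (b := R)).bddAbove_image
    (f := fun ξ => R * β (ξ / R)) (by fun_prop)
  refine ((Metric.isBounded_Icc (R / 2) R).prod (Metric.isBounded_Icc 0 M)).subset ?_
  rintro ⟨ξ, η⟩ ⟨h1, h2⟩
  exact ⟨⟨h1.1.le, h1.2⟩, h2.1.le, h2.2.le.trans (hM ⟨ξ, ⟨h1.1.le, h1.2⟩, rfl⟩)⟩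

theorem setIntegral_dilatedRegion {β : ℝ → ℝ} (hβ : Continuous β) {R : ℝ} (hR : 0 < R)
    (hβ0 : ∀ ξ, 0 ≤ ξ → 0 ≤ β ξ) (lam p q : ℝ) :
    ∫ w in dilatedRegion β R, osc lam p q w =
      ∫ ξ in (R / 2)..R, ∫ η in (0 : ℝ)..(R * β (ξ / R)), osc lam p q (ξ, η) := by
  have hm := measurableSet_dilatedRegion hβ R
  rw [← integral_indicator hm, Measure.volume_eq_prod, integral_prod,
    intervalIntegral.integral_of_le (by linarith), ← integral_indicator measurableSet_Ioc]
  · refine integral_congr_ae (Filter.Eventually.of_forall fun ξ => ?_)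
    by_cases hξ : ξ ∈ Set.Ioc (R / 2) R
    · have h0 : 0 ≤ R * β (ξ / R) := mul_nonneg hR.le
        (hβ0 _ (div_nonneg (by linarith [hξ.1]) hR.le))
      rw [Set.indicator_of_mem hξ, intervalIntegral.integral_of_le h0, integral_Ioc_eq_integral_Ioo,
        ← integral_indicator measurableSet_Ioo]
      refine integral_congr_ae (Filter.Eventually.of_forall fun η => ?_)
      by_cases hη : η ∈ Set.Ioo 0 (R * β (ξ / R))
      · have : (ξ, η) ∈ dilatedRegion β R := ⟨hξ, hη⟩
        simp only [Set.indicator_of_mem this, Set.indicator_of_mem hη]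
      · have : (ξ, η) ∉ dilatedRegion β R := fun h => hη h.2
        simp only [Set.indicator_of_notMem this, Set.indicator_of_notMem hη]
    · rw [Set.indicator_of_notMem hξ]
      have : ∀ η, (ξ, η) ∉ dilatedRegion β R := fun η h => hξ h.1
      simp [Set.indicator_of_notMem (this _)]
  · rw [← Measure.volume_eq_prod]
    exact (integrableOn_osc_of_bounded lam p q (isBounded_dilatedRegion hβ)).integrable_indicator hm

theorem setIntegral_dilatedRegion_eq_stripIntegral {β : ℝ → ℝ} (hβ : Continuous β) {R : ℝ}
    (hR : 0 < R) (hβ0 : ∀ ξ, 0 ≤ ξ → 0 ≤ β ξ) {lam : ℝ} (hl : 0 < lam) (p q : ℝ) :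
    ∫ w in dilatedRegion β R, osc lam p q w =
      R ^ 2 * stripIntegral (√(lam * R ^ 3)) (R * p) (R * q / (6 * (lam * R ^ 3))) β (1 / 2) 1 := by
  rw [setIntegral_dilatedRegion hβ hR hβ0, stripIntegral]
  have hk : √(lam * R ^ 3) ^ 2 = lam * R ^ 3 := Real.sq_sqrt (by positivity)
  have h1 := intervalIntegral.smul_integral_comp_mul_left (a := (1 / 2 : ℝ)) (b := 1) R
    (f := fun ξ => ∫ η in (0 : ℝ)..(R * β (ξ / R)), osc lam p q (ξ, η))
  have h2 : ∀ ξ : ℝ, ∫ η in (0 : ℝ)..(R * β ξ), osc lam p q (R * ξ, η) =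
      R * ∫ η in (0 : ℝ)..β ξ, osc lam p q (R * ξ, R * η) := fun ξ => by
    have := intervalIntegral.smul_integral_comp_mul_left (a := (0 : ℝ)) (b := β ξ) R
      (f := fun η => osc lam p q (R * ξ, η))
    rw [mul_zero, Complex.real_smul] at this
    exact this.symm
  simp only [mul_div_cancel_left₀ _ hR.ne', h2] at h1
  rw [show R * (1 / 2) = R / 2 by ring, mul_one, Complex.real_smul] at h1
  rw [← h1, intervalIntegral.integral_const_mul, ← mul_assoc, ← sq]
  congr 3
  ext ξ
  congr 1
  ext η
  simp only [osc, phiNV, hk]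
  congr 1
  field_simp
  ring

theorem norm_setIntegral_dilatedRegion_le {β : ℝ → ℝ} (hβ : Continuous β) {R : ℝ}
    (hR : 0 < R) (hβ0 : ∀ ξ, 0 ≤ ξ → 0 ≤ β ξ) {lam : ℝ} (hl : 0 < lam) (p q : ℝ) {C : ℝ}
    (hC : ∀ k x Y : ℝ, 0 < k → ‖stripIntegral k x Y β (1 / 2) 1‖ ≤ C / k ^ 2) :
    ‖∫ w in dilatedRegion β R, osc lam p q w‖ ≤ C / (lam * R) := by
  rw [setIntegral_dilatedRegion_eq_stripIntegral hβ hR hβ0 hl, norm_mul]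
  have hk : √(lam * R ^ 3) ^ 2 = lam * R ^ 3 := Real.sq_sqrt (by positivity)
  have h := hC (√(lam * R ^ 3)) (R * p) (R * q / (6 * (lam * R ^ 3)))
    (Real.sqrt_pos.2 (by positivity))
  rw [hk] at h
  calc ‖(R : ℂ) ^ 2‖ * _ ≤ R ^ 2 * (C / (lam * R ^ 3)) := by
        rw [norm_pow, Complex.norm_real, Real.norm_of_nonneg hR.le]
        gcongr
    _ = C / (lam * R) := by field_simp

/-- The part of the annulus `R ≤ |w| < 2R` at angles in `(0, π/3)`. -/
def annularSector (R : ℝ) : Set (ℝ × ℝ) :=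
  {w | R ^ 2 ≤ w.1 ^ 2 + w.2 ^ 2 ∧ w.1 ^ 2 + w.2 ^ 2 < (2 * R) ^ 2 ∧ 0 < w.2 ∧ w.2 < √3 * w.1}

theorem mem_dilatedRegion_line {R : ℝ} (hR : 0 < R) (w : ℝ × ℝ) :
    w ∈ dilatedRegion (fun ξ => √3 * ξ) R ↔
      (R / 2 < w.1 ∧ w.1 ≤ R) ∧ 0 < w.2 ∧ w.2 < √3 * w.1 := by
  have : R * (√3 * (w.1 / R)) = √3 * w.1 := by field_simp
  simp only [dilatedRegion, regionBetween, Set.mem_ofPred_eq, Set.mem_Ioc, Set.mem_Ioo, this]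

theorem mem_dilatedRegion_arc {R : ℝ} (hR : 0 < R) (w : ℝ × ℝ) :
    w ∈ dilatedRegion arc R ↔
      (R / 2 < w.1 ∧ w.1 ≤ R) ∧ 0 < w.2 ∧ w.1 ^ 2 + w.2 ^ 2 < R ^ 2 := by
  have h : R * arc (w.1 / R) = √(R ^ 2 - w.1 ^ 2) := by
    rw [arc, show R ^ 2 - w.1 ^ 2 = R ^ 2 * (1 - (w.1 / R) ^ 2) by field_simp,
      Real.sqrt_mul (by positivity), Real.sqrt_sq hR.le]
  simp only [dilatedRegion, regionBetween, Set.mem_ofPred_eq, Set.mem_Ioc, Set.mem_Ioo, h]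
  refine and_congr_right fun _ => and_congr_right fun h0 => ?_
  rw [Real.lt_sqrt h0.le]
  constructor <;> intro _ <;> linarith

theorem lt_sqrt_three_mul_iff {ξ η : ℝ} (hξ : 0 ≤ ξ) (hη : 0 ≤ η) :
    η < √3 * ξ ↔ η ^ 2 < 3 * ξ ^ 2 := by
  rw [← sq_lt_sq₀ hη (by positivity), mul_pow, Real.sq_sqrt (by norm_num)]

theorem dilatedRegion_arc_subset_line {R : ℝ} (hR : 0 < R) :
    dilatedRegion arc R ⊆ dilatedRegion (fun ξ => √3 * ξ) R := by
  intro w hw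
  rw [mem_dilatedRegion_arc hR] at hw
  obtain ⟨h1, h2, h3⟩ := hw
  rw [mem_dilatedRegion_line hR, lt_sqrt_three_mul_iff (by linarith) h2.le]
  exact ⟨h1, h2, by nlinarith⟩

theorem annularSector_eq {R : ℝ} (hR : 0 < R) :
    annularSector R = (dilatedRegion (fun ξ => √3 * ξ) R \ dilatedRegion arc R) ∪
      dilatedRegion arc (2 * R) := by
  ext w
  rw [Set.mem_union, Set.mem_sdiff, mem_dilatedRegion_line hR, mem_dilatedRegion_arc hR,
    mem_dilatedRegion_arc (by linarith)]
  simp only [annularSector, Set.mem_ofPred_eq]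
  by_cases h2 : 0 < w.2
  swap
  · simp [h2]
  by_cases h1 : 0 < w.1
  swap
  · have : ¬ w.2 < √3 * w.1 := by
      have := mul_nonneg (Real.sqrt_nonneg 3) (neg_nonneg.2 (not_lt.1 h1))
      linarith
    have h' : ¬ R < w.1 := by linarith
    simp [this, h']
  rw [lt_sqrt_three_mul_iff h1.le h2.le]
  constructor
  · rintro ⟨ha, hb, -, hc⟩
    rcases le_or_gt w.1 R with h | h
    · exact Or.inl ⟨⟨⟨by nlinarith, h⟩, h2, hc⟩, fun h' => by linarith [h'.2.2]⟩
    · exact Or.inr ⟨⟨by linarith, by nlinarith⟩, h2, hb⟩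
  · rintro (⟨⟨⟨ha, hb⟩, -, hc⟩, hd⟩ | ⟨⟨ha, hb⟩, -, hc⟩)
    · exact ⟨by by_contra h; exact hd ⟨⟨ha, hb⟩, h2, by linarith⟩, by nlinarith, h2, hc⟩
    · exact ⟨by nlinarith, hc, h2, by nlinarith⟩

theorem norm_setIntegral_annularSector_le_of_pos {R : ℝ} (hR : 0 < R) {lam : ℝ} (hl : 0 < lam)
    (p q : ℝ) : ‖∫ w in annularSector R, osc lam p q w‖ ≤ 70000 / (lam * R) := by
  have hline : Continuous fun ξ : ℝ => √3 * ξ := by fun_prop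
  have hm : ∀ r, MeasurableSet (dilatedRegion arc r) := measurableSet_dilatedRegion continuous_arc
  have hi : ∀ r, IntegrableOn (osc lam p q) (dilatedRegion arc r) := fun r =>
    integrableOn_osc_of_bounded lam p q (isBounded_dilatedRegion continuous_arc)
  have hi' : IntegrableOn (osc lam p q) (dilatedRegion (fun ξ => √3 * ξ) R) :=
    integrableOn_osc_of_bounded lam p q (isBounded_dilatedRegion hline)
  have hdisj : Disjoint (dilatedRegion (fun ξ => √3 * ξ) R \ dilatedRegion arc R)
      (dilatedRegion arc (2 * R)) := by
    refine Set.disjoint_left.2 fun w h h' => ?_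
    have h1 := ((mem_dilatedRegion_line hR w).1 h.1).1.2
    have h2 := ((mem_dilatedRegion_arc (by linarith) w).1 h').1.1
    linarith
  rw [annularSector_eq hR, setIntegral_union hdisj (hm _) (hi'.mono_set Set.sdiff_subset) (hi _),
    setIntegral_sdiff (hm _) hi' (dilatedRegion_arc_subset_line hR)]
  have harc : ∀ r, 0 < r → ‖∫ w in dilatedRegion arc r, osc lam p q w‖ ≤ 44000 / (lam * r) :=
    fun r hr => norm_setIntegral_dilatedRegion_le continuous_arc hr (fun ξ _ => arc_nonneg ξ) hl p q
      fun k x Y hk => norm_stripIntegral_arc_le hk x Y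
  have h1 := norm_setIntegral_dilatedRegion_le hline hR (fun ξ hξ => by positivity) hl p q
    fun k x Y hk => norm_stripIntegral_line_le hk x Y
  refine (norm_add_le _ _).trans ((add_le_add_left (norm_sub_le _ _) _).trans
    ((add_le_add (add_le_add h1 (harc R hR)) (harc (2 * R) (by linarith))).trans ?_))
  rw [show 44000 / (lam * (2 * R)) = 22000 / (lam * R) by field_simp; norm_num, ← add_div, ← add_div]
  gcongr
  norm_num

theorem norm_setIntegral_annularSector_le {R : ℝ} (hR : 0 < R) {lam : ℝ} (hl : lam ≠ 0)
    (p q : ℝ) : ‖∫ w in annularSector R, osc lam p q w‖ ≤ 70000 / (|lam| * R) := by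
  rcases hl.lt_or_gt with h | h
  · have h1 := norm_setIntegral_annularSector_le_of_pos hR (neg_pos.2 h) (-p) (-q)
    have h2 : ∀ w, osc (-lam) (-p) (-q) w = starRingEnd ℂ (osc lam p q w) := fun w => by
      rw [osc, osc, conj_cis]
      congr 1
      ring
    simp_rw [h2] at h1
    rwa [integral_conj, RCLike.norm_conj, ← abs_of_neg h] at h1
  · rw [abs_of_pos h]
    exact norm_setIntegral_annularSector_le_of_pos hR h p q

/-- Volume-preserving changes of variables that leave `φ` and the Euclidean norm invariant and
permute the linear phases. -/
structure IsPhaseSymmetry (g : ℝ × ℝ → ℝ × ℝ) : Prop where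
  measurePreserving : MeasurePreserving g
  measurableEmbedding : MeasurableEmbedding g
  norm_sq_eq : ∀ w, (g w).1 ^ 2 + (g w).2 ^ 2 = w.1 ^ 2 + w.2 ^ 2
  osc_eq : ∀ lam p q, ∃ p' q', ∀ w, osc lam p q w = osc lam p' q' (g w)

theorem IsPhaseSymmetry.id : IsPhaseSymmetry id :=
  ⟨MeasurePreserving.id _, MeasurableEmbedding.id, fun _ => rfl, fun _ p q => ⟨p, q, fun _ => rfl⟩⟩

theorem IsPhaseSymmetry.comp {g h : ℝ × ℝ → ℝ × ℝ} (hg : IsPhaseSymmetry g)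
    (hh : IsPhaseSymmetry h) : IsPhaseSymmetry (g ∘ h) where
  measurePreserving := hg.measurePreserving.comp hh.measurePreserving
  measurableEmbedding := hg.measurableEmbedding.comp hh.measurableEmbedding
  norm_sq_eq w := (hg.norm_sq_eq (h w)).trans (hh.norm_sq_eq w)
  osc_eq lam p q := by
    obtain ⟨p₁, q₁, h₁⟩ := hh.osc_eq lam p q
    obtain ⟨p₂, q₂, h₂⟩ := hg.osc_eq lam p₁ q₁
    exact ⟨p₂, q₂, fun w => (h₁ w).trans (h₂ (h w))⟩

theorem norm_setIntegral_preimage_annularSector_le {g : ℝ × ℝ → ℝ × ℝ} (hg : IsPhaseSymmetry g)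
    {R : ℝ} (hR : 0 < R) {lam : ℝ} (hl : lam ≠ 0) (p q : ℝ) :
    ‖∫ w in g ⁻¹' annularSector R, osc lam p q w‖ ≤ 70000 / (|lam| * R) := by
  obtain ⟨p', q', h⟩ := hg.osc_eq lam p q
  simp_rw [h]
  rw [hg.measurePreserving.setIntegral_preimage_emb hg.measurableEmbedding]
  exact norm_setIntegral_annularSector_le hR hl p' q'

theorem measurePreserving_of_pow_eq_one {f : ℝ × ℝ →ₗ[ℝ] ℝ × ℝ} {n : ℕ} (hn : n ≠ 0)
    (hf : f ^ n = 1) : MeasurePreserving f := by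
  have h1 : |LinearMap.det f| = 1 := by
    have h : |LinearMap.det f| ^ n = 1 := by rw [← abs_pow, ← map_pow, hf]; simp
    exact (pow_eq_one_iff_of_nonneg (abs_nonneg _) hn).1 h
  have h0 : LinearMap.det f ≠ 0 := fun h => by simp [h] at h1
  refine ⟨f.continuous_of_finiteDimensional.measurable, ?_⟩
  rw [Measure.map_linearMap_addHaar_eq_smul_addHaar _ h0, abs_inv, h1]
  simp

theorem measurableEmbedding_of_pow_eq_one {f : ℝ × ℝ →ₗ[ℝ] ℝ × ℝ} {n : ℕ} (hn : n ≠ 0)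
    (hf : f ^ n = 1) : MeasurableEmbedding f := by
  refine f.continuous_of_finiteDimensional.measurableEmbedding ?_
  have : Function.LeftInverse (f ^ (n - 1)) f := fun w => by
    rw [← Module.End.mul_apply, ← pow_succ, Nat.sub_add_cancel (Nat.pos_of_ne_zero hn), hf]
    rfl
  exact this.injective

/-- Reflection in the first axis. -/
def planeReflection : ℝ × ℝ →ₗ[ℝ] ℝ × ℝ :=
  LinearMap.prod (LinearMap.fst ℝ ℝ ℝ) (-LinearMap.snd ℝ ℝ ℝ)

/-- Rotation by the angle `2π/3`. -/
noncomputable def planeRotation : ℝ × ℝ →ₗ[ℝ] ℝ × ℝ :=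
  LinearMap.prod
    ((-(1 / 2) : ℝ) • LinearMap.fst ℝ ℝ ℝ + (-(√3 / 2) : ℝ) • LinearMap.snd ℝ ℝ ℝ)
    ((√3 / 2 : ℝ) • LinearMap.fst ℝ ℝ ℝ + (-(1 / 2) : ℝ) • LinearMap.snd ℝ ℝ ℝ)

theorem planeReflection_apply (w : ℝ × ℝ) : planeReflection w = (w.1, -w.2) := rfl

theorem planeRotation_apply (w : ℝ × ℝ) :
    planeRotation w = (-(1 / 2) * w.1 + -(√3 / 2) * w.2, √3 / 2 * w.1 + -(1 / 2) * w.2) := rfl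

theorem planeReflection_sq : planeReflection ^ 2 = 1 := by
  refine LinearMap.ext fun w => ?_
  simp [sq, planeReflection_apply]

theorem planeRotation_cube : planeRotation ^ 3 = 1 := by
  have h3 : √3 ^ 2 = 3 := Real.sq_sqrt (by norm_num)
  refine LinearMap.ext fun w => ?_
  simp only [pow_succ, pow_zero, one_mul, Module.End.mul_apply, planeRotation_apply,
    Module.End.one_apply]
  ext
  · linear_combination (3 / 8 * w.1 + √3 / 8 * w.2) * h3
  · linear_combination (-√3 / 8 * w.1 + 3 / 8 * w.2) * h3

theorem isPhaseSymmetry_planeReflection : IsPhaseSymmetry planeReflection where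
  measurePreserving := measurePreserving_of_pow_eq_one two_ne_zero planeReflection_sq
  measurableEmbedding := measurableEmbedding_of_pow_eq_one two_ne_zero planeReflection_sq
  norm_sq_eq w := by simp [planeReflection_apply]
  osc_eq lam p q := ⟨p, -q, fun w => by simp [osc, phiNV, planeReflection_apply]⟩

theorem isPhaseSymmetry_planeRotation : IsPhaseSymmetry planeRotation where
  measurePreserving := measurePreserving_of_pow_eq_one three_ne_zero planeRotation_cube
  measurableEmbedding := measurableEmbedding_of_pow_eq_one three_ne_zero planeRotation_cube
  norm_sq_eq w := by
    have h3 : √3 ^ 2 = 3 := Real.sq_sqrt (by norm_num)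
    rw [planeRotation_apply]
    linear_combination (w.1 ^ 2 + w.2 ^ 2) / 4 * h3
  osc_eq lam p q := by
    have h3 : √3 ^ 2 = 3 := Real.sq_sqrt (by norm_num)
    have h33 : √3 ^ 3 = 3 * √3 := by rw [pow_succ, h3]
    refine ⟨-(1 / 2) * p - √3 / 2 * q, √3 / 2 * p - 1 / 2 * q, fun w => ?_⟩
    rw [osc, osc, planeRotation_apply, phiNV, phiNV]
    congr 1
    ring_nf
    rw [h33, h3]
    ring

theorem ae_linear_ne_zero {ℓ : ℝ × ℝ →ₗ[ℝ] ℝ} (hℓ : ℓ ≠ 0) : ∀ᵐ w : ℝ × ℝ, ℓ w ≠ 0 :=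
  measure_eq_zero_iff_ae_notMem.1
    (Measure.addHaar_submodule volume (LinearMap.ker ℓ) fun h => hℓ (LinearMap.ker_eq_top.1 h))

/-- The six reflected and rotated copies of the chamber `0 < b < a` partition the complement of
the lines bounding them. -/
theorem sum_chambers {a b : ℝ} (h0 : b ≠ 0) (h1 : a ≠ b) (h2 : a ≠ -b) (z : ℂ) :
    z = (if 0 < b ∧ b < a then z else 0) + (if 0 < -b ∧ -b < a then z else 0) +
      (if b < a ∧ a < -b then z else 0) + (if a < b ∧ b < 0 then z else 0) +
      (if 0 < b ∧ a < -b then z else 0) + (if -b < a ∧ a < b then z else 0) := by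
  rcases lt_or_gt_of_ne h0 with h0 | h0 <;> rcases lt_or_gt_of_ne h1 with h1 | h1 <;>
    rcases lt_or_gt_of_ne h2 with h2 | h2 <;> (try (exfalso; linarith)) <;>
    simp [h0, h1, h2, h0.le, h1.le, h2.le, not_lt.2]

/-- The annulus `R ≤ |w| < 2R`. -/
def annulus (R : ℝ) : Set (ℝ × ℝ) :=
  {w | R ^ 2 ≤ w.1 ^ 2 + w.2 ^ 2 ∧ w.1 ^ 2 + w.2 ^ 2 < (2 * R) ^ 2}

theorem isBounded_annulus (R : ℝ) : Bornology.IsBounded (annulus R) := by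
  refine ((Metric.isBounded_Icc (-|2 * R|) |2 * R|).prod
    (Metric.isBounded_Icc (-|2 * R|) |2 * R|)).subset fun w hw => ?_
  exact ⟨abs_le.1 (sq_le_sq.1 (by nlinarith [hw.2, sq_nonneg w.2])),
    abs_le.1 (sq_le_sq.1 (by nlinarith [hw.2, sq_nonneg w.1]))⟩

theorem measurableSet_annulus (R : ℝ) : MeasurableSet (annulus R) := by
  unfold annulus
  measurability

theorem measurableSet_annularSector (R : ℝ) : MeasurableSet (annularSector R) := by
  unfold annularSector
  measurability

theorem mem_preimage_annularSector {g : ℝ × ℝ → ℝ × ℝ} (hg : IsPhaseSymmetry g) (R : ℝ)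
    (w : ℝ × ℝ) : w ∈ g ⁻¹' annularSector R ↔
      w ∈ annulus R ∧ 0 < (g w).2 ∧ (g w).2 < √3 * (g w).1 := by
  simp only [Set.mem_preimage, annularSector, annulus, Set.mem_ofPred_eq, hg.norm_sq_eq, and_assoc]

theorem indicator_preimage_annularSector {g : ℝ × ℝ → ℝ × ℝ} (hg : IsPhaseSymmetry g) {R : ℝ}
    {w : ℝ × ℝ} (hw : w ∈ annulus R) (f : ℝ × ℝ → ℂ) :
    (g ⁻¹' annularSector R).indicator f w =
      if 0 < (g w).2 ∧ (g w).2 < √3 * (g w).1 then f w else 0 := by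
  classical
  rw [Set.indicator_apply]
  exact if_congr ((mem_preimage_annularSector hg R w).trans (and_iff_right hw)) rfl rfl

theorem indicator_preimage_annularSector_of_notMem {g : ℝ × ℝ → ℝ × ℝ} (hg : IsPhaseSymmetry g)
    {R : ℝ} {w : ℝ × ℝ} (hw : w ∉ annulus R) (f : ℝ × ℝ → ℂ) :
    (g ⁻¹' annularSector R).indicator f w = 0 :=
  Set.indicator_of_notMem (fun h => hw ((mem_preimage_annularSector hg R w).1 h).1) f

theorem sqrt_three_mul_planeRotation_fst (w : ℝ × ℝ) :
    √3 * (planeRotation w).1 = -(√3 * w.1) / 2 - 3 / 2 * w.2 := by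
  have h3 : √3 ^ 2 = 3 := Real.sq_sqrt (by norm_num)
  rw [planeRotation_apply]
  linear_combination -w.2 / 2 * h3

theorem planeRotation_snd (w : ℝ × ℝ) : (planeRotation w).2 = √3 * w.1 / 2 - w.2 / 2 := by
  rw [planeRotation_apply]
  ring

theorem indicator_annulus_ae_eq (R : ℝ) (f : ℝ × ℝ → ℂ) :
    (annulus R).indicator f =ᵐ[volume]
      (id ⁻¹' annularSector R).indicator f +
      (planeReflection ⁻¹' annularSector R).indicator f +
      (planeRotation ⁻¹' annularSector R).indicator f +
      ((planeReflection ∘ planeRotation) ⁻¹' annularSector R).indicator f +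
      ((planeRotation ∘ planeRotation) ⁻¹' annularSector R).indicator f +
      ((planeReflection ∘ planeRotation ∘ planeRotation) ⁻¹' annularSector R).indicator f := by
  have e0 := ae_linear_ne_zero (ℓ := LinearMap.snd ℝ ℝ ℝ)
    fun h => by simpa using LinearMap.congr_fun h (0, 1)
  have e1 := ae_linear_ne_zero (ℓ := √3 • LinearMap.fst ℝ ℝ ℝ - LinearMap.snd ℝ ℝ ℝ)
    fun h => by simpa using LinearMap.congr_fun h (0, 1)
  have e2 := ae_linear_ne_zero (ℓ := √3 • LinearMap.fst ℝ ℝ ℝ + LinearMap.snd ℝ ℝ ℝ)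
    fun h => by simpa using LinearMap.congr_fun h (0, 1)
  have s1 := isPhaseSymmetry_planeReflection
  have s2 := isPhaseSymmetry_planeRotation
  filter_upwards [e0, e1, e2] with w h0 h1 h2
  replace h0 : w.2 ≠ 0 := h0
  replace h1 : √3 * w.1 - w.2 ≠ 0 := h1
  replace h2 : √3 * w.1 + w.2 ≠ 0 := h2
  have key := sum_chambers h0 (sub_ne_zero.1 h1) (fun h => h2 (by linarith)) (f w)
  have s0 := IsPhaseSymmetry.id
  have s3 := s1.comp s2
  have s4 := s2.comp s2
  have s5 := s1.comp s4
  simp only [Pi.add_apply]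
  by_cases hA : w ∈ annulus R
  swap
  · rw [indicator_preimage_annularSector_of_notMem s0 hA,
      indicator_preimage_annularSector_of_notMem s1 hA,
      indicator_preimage_annularSector_of_notMem s2 hA,
      indicator_preimage_annularSector_of_notMem s3 hA,
      indicator_preimage_annularSector_of_notMem s4 hA,
      indicator_preimage_annularSector_of_notMem s5 hA, Set.indicator_of_notMem hA]
    simp
  rw [indicator_preimage_annularSector s0 hA, indicator_preimage_annularSector s1 hA,
    indicator_preimage_annularSector s2 hA, indicator_preimage_annularSector s3 hA,
    indicator_preimage_annularSector s4 hA, indicator_preimage_annularSector s5 hA,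
    Set.indicator_of_mem hA]
  simp only [Function.comp_apply, planeReflection_apply, planeRotation_snd,
    sqrt_three_mul_planeRotation_fst, id]
  refine key.trans ?_
  congr 1; congr 1; congr 1; congr 1
  all_goals
    refine if_congr ⟨fun h => ?_, fun h => ?_⟩ rfl rfl <;>
      constructor <;> linarith [h.1, h.2]

theorem norm_setIntegral_annulus_le {R : ℝ} (hR : 0 < R) {lam : ℝ} (hl : lam ≠ 0) (p q : ℝ) :
    ‖∫ w in annulus R, osc lam p q w‖ ≤ 420000 / (|lam| * R) := by
  have hm : ∀ g, IsPhaseSymmetry g → MeasurableSet (g ⁻¹' annularSector R) := fun g hg =>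
    hg.measurableEmbedding.measurable (measurableSet_annularSector R)
  have hi : ∀ g, IsPhaseSymmetry g →
      Integrable ((g ⁻¹' annularSector R).indicator (osc lam p q)) := fun g hg =>
    ((integrableOn_osc_of_bounded lam p q (isBounded_annulus R)).mono_set fun w hw =>
      ((mem_preimage_annularSector hg R w).1 hw).1).integrable_indicator (hm g hg)
  have hb : ∀ g, IsPhaseSymmetry g →
      ‖∫ w, (g ⁻¹' annularSector R).indicator (osc lam p q) w‖ ≤ 70000 / (|lam| * R) :=
    fun g hg => by
      rw [integral_indicator (hm g hg)]
      exact norm_setIntegral_preimage_annularSector_le hg hR hl p q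
  have s0 := IsPhaseSymmetry.id
  have s1 := isPhaseSymmetry_planeReflection
  have s2 := isPhaseSymmetry_planeRotation
  have s3 := s1.comp s2
  have s4 := s2.comp s2
  have s5 := s1.comp s4
  rw [← integral_indicator (measurableSet_annulus R),
    integral_congr_ae (indicator_annulus_ae_eq R (osc lam p q)),
    integral_add' ((((hi _ s0).add (hi _ s1)).add (hi _ s2)).add (hi _ s3) |>.add (hi _ s4))
      (hi _ s5),
    integral_add' ((((hi _ s0).add (hi _ s1)).add (hi _ s2)).add (hi _ s3)) (hi _ s4),
    integral_add' (((hi _ s0).add (hi _ s1)).add (hi _ s2)) (hi _ s3),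
    integral_add' ((hi _ s0).add (hi _ s1)) (hi _ s2), integral_add' (hi _ s0) (hi _ s1)]
  refine (norm_add_le_of_le (norm_add_le_of_le (norm_add_le_of_le (norm_add_le_of_le
    (norm_add_le_of_le (hb _ s0) (hb _ s1)) (hb _ s2)) (hb _ s3)) (hb _ s4)) (hb _ s5)).trans_eq ?_
  ring

theorem annulus_iff {R : ℝ} (hR : 0 ≤ R) (w : ℝ × ℝ) :
    w ∈ annulus R ↔ R ≤ √(w.1 ^ 2 + w.2 ^ 2) ∧ √(w.1 ^ 2 + w.2 ^ 2) < 2 * R := by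
  rw [Real.le_sqrt hR (by positivity), annulus, Set.mem_ofPred_eq]
  refine and_congr_right fun _ => ?_
  by_cases h : R = 0
  · subst h
    simp only [mul_zero, ne_eq, OfNat.ofNat_ne_zero, not_false_eq_true, zero_pow]
    exact iff_of_false (not_lt.2 (by positivity)) (not_lt.2 (by positivity))
  · rw [Real.sqrt_lt' (by positivity)]

theorem UphiLP_eq (l : ℕ) (t : ℝ) (u₀ : SchwartzMap (ℝ × ℝ) ℂ) (v : ℝ × ℝ) :
    UphiLP l t u₀ v = (2 * Real.pi : ℂ)⁻¹ ^ 2 *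
      ∫ x : ℝ × ℝ, (∫ w in annulus (2 ^ l), osc (-t) (v.1 - x.1) (v.2 - x.2) w) * u₀ x := by
  have hm := measurableSet_annulus (2 ^ l)
  have hfin : IsFiniteMeasure (volume.restrict (annulus (2 ^ l))) :=
    ⟨by rw [Measure.restrict_apply_univ]; exact (isBounded_annulus _).measure_lt_top⟩
  have hF : Integrable (Function.uncurry fun w x : ℝ × ℝ =>
      osc (-t) (v.1 - x.1) (v.2 - x.2) w * u₀ x)
      ((volume.restrict (annulus (2 ^ l))).prod volume) := by
    refine (Integrable.mul_prod (f := fun _ : ℝ × ℝ => (1 : ℂ)) (integrable_const _)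
      u₀.integrable).mono ?_ (Filter.Eventually.of_forall fun z => ?_)
    · refine Continuous.aestronglyMeasurable ?_
      have := u₀.continuous
      unfold osc phiNV Function.uncurry
      exact (continuous_cis.comp (by fun_prop)).mul (by fun_prop)
    · simp [Function.uncurry, norm_osc]
  unfold UphiLP
  congr 1
  simp_rw [← integral_mul_const]
  rw [← integral_integral_swap hF, ← integral_indicator hm]
  congr 1
  ext w
  have hR : (0 : ℝ) ≤ 2 ^ l := by positivity
  by_cases hw : w ∈ annulus (2 ^ l)
  · rw [Set.indicator_of_mem hw]
    rw [annulus_iff hR, ← pow_succ'] at hw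
    rw [if_pos hw, one_mul, FT2, ← integral_const_mul]
    congr 1
    ext x
    rw [← mul_assoc, ← Complex.exp_add, osc, cis]
    congr 2
    push_cast
    ring
  · rw [Set.indicator_of_notMem hw]
    rw [annulus_iff hR, ← pow_succ'] at hw
    rw [if_neg hw, zero_mul, zero_mul]

/-- Frequency-localized dispersive estimate with derivative gain:
`‖U_φ(t) P_{Δl} u₀‖_{L^∞} ≤ C |t|⁻¹ 2^{−l} ‖u₀‖_{L¹}` uniformly in `l`. -/
theorem dispersive_estimate_LP :
    ∃ C > (0 : ℝ), ∀ l : ℕ, ∀ t : ℝ, t ≠ 0 → ∀ u₀ : SchwartzMap (ℝ × ℝ) ℂ, ∀ v : ℝ × ℝ,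
      ‖UphiLP l t u₀ v‖ ≤ C * |t|⁻¹ * ((2 : ℝ) ^ l)⁻¹ * ∫ x : ℝ × ℝ, ‖u₀ x‖ := by
  refine ⟨(2 * Real.pi)⁻¹ ^ 2 * 420000, by positivity, fun l t ht u₀ v => ?_⟩
  have hR : (0 : ℝ) < 2 ^ l := by positivity
  have h1 : ‖(2 * Real.pi : ℂ)⁻¹ ^ 2‖ = (2 * Real.pi)⁻¹ ^ 2 := by
    simp [abs_of_pos Real.pi_pos]
  rw [UphiLP_eq, norm_mul, h1, mul_assoc, mul_assoc, mul_assoc]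
  gcongr
  refine (norm_integral_le_of_norm_le (g := fun x => 420000 / (|(-t)| * 2 ^ l) * ‖u₀ x‖)
    (u₀.integrable.norm.const_mul _) (Filter.Eventually.of_forall fun x => ?_)).trans_eq ?_
  · rw [norm_mul]
    gcongr
    exact norm_setIntegral_annulus_le hR (neg_ne_zero.2 ht) _ _
  · rw [integral_const_mul, abs_neg]
    field_simp
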